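/- arXiv:math/0408034 — 4 statements merged into one kernel-verified Lean document; each statement's English description precedes it below -/
import Mathlib

section
/- For each sign ε ∈ {+,−}, the operators π_ε(a) and π_ε(b), defined on the dense span of the orthonormal basis of H_h, extend to bounded linear operators on H_h; moreover the bounded extension of π_ε(b) is self-adjoint. -/
noncomputable section

open scoped ComplexConjugate ENNReal InnerProductSpace

/-- Validity predicate for basis indices: the pair `(L, M)` of integers encodes the pair of
half-integers `(l, m) = (L/2, M/2)` with `l ∈ {1/2, 3/2, …}` and `m ∈ {-l, …, l}`. -/
def IdxP (p : ℤ × ℤ) : Prop := 0 < p.1 ∧ Odd p.1 ∧ Odd p.2 ∧ |p.2| ≤ p.1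

instance (p : ℤ × ℤ) : Decidable (IdxP p) := Classical.dec _

/-- The index set of the orthonormal basis `|l,m⟩`; `(L, M)` encodes `l = L/2`, `m = M/2`. -/
abbrev Idx : Type := { p : ℤ × ℤ // IdxP p }

/-- The Hilbert space `H_h`, realized as `ℓ²` over the basis index set. -/
abbrev Hh : Type := lp (fun _ : Idx => ℂ) 2

/-- The basis vector `|l,m⟩` of `H_h` (with `L = 2l`, `M = 2m`), defined to be `0` when the
index is out of the allowed range. -/
def ket (L M : ℤ) : Hh :=
  if h : IdxP (L, M) then lp.single 2 (⟨(L, M), h⟩ : Idx) 1 else 0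

/-- The basis vector of `H_h` attached to a valid index. -/
def ebs (p : Idx) : Hh := lp.single 2 p 1

/-- The `q`-number `[x] = (q^x - q^{-x})/(q - q⁻¹)`. -/
def qn (q x : ℝ) : ℝ := (q ^ x - q ^ (-x)) / (q - q⁻¹)

/-- Coefficient of `|l, m+1⟩` in `π_ε(a)|l,m⟩`. -/
def aC1 (q ε l m : ℝ) : ℝ :=
  ε * (1 + q ^ 2) * (q ^ (m - 1/2) / (qn q (2*l) * qn q (2*l + 2))) *
    Real.sqrt (qn q (l + m + 1) * qn q (l - m))

/-- Coefficient of `|l+1, m+1⟩` in `π_ε(a)|l,m⟩`. -/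
def aC2 (q l m : ℝ) : ℝ :=
  q ^ (m - l - 1/2) / qn q (2*l + 2) * Real.sqrt (qn q (l + m + 1) * qn q (l + m + 2))

/-- Coefficient of `|l-1, m+1⟩` in `π_ε(a)|l,m⟩` (which enters with a minus sign). -/
def aC3 (q l m : ℝ) : ℝ :=
  q ^ (m + l + 1/2) / qn q (2*l) * Real.sqrt (qn q (l - m) * qn q (l - m - 1))

/-- Coefficient of `|l, m⟩` in `π_ε(b)|l,m⟩`. -/
def bC1 (q ε l m : ℝ) : ℝ :=
  ε * ((qn q (l - m + 1) * qn q (l + m) - q ^ 2 * (qn q (l - m) * qn q (l + m + 1))) /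
    (qn q (2*l) * qn q (2*l + 2)))

/-- Coefficient of `|l+1, m⟩` in `π_ε(b)|l,m⟩` (which enters with a minus sign). -/
def bC2 (q l m : ℝ) : ℝ :=
  q ^ (m + 1) / qn q (2*l + 2) * Real.sqrt (qn q (l - m + 1) * qn q (l + m + 1))

/-- Coefficient of `|l-1, m⟩` in `π_ε(b)|l,m⟩` (which enters with a minus sign). -/
def bC3 (q l m : ℝ) : ℝ :=
  q ^ (m + 1) / qn q (2*l) * Real.sqrt (qn q (l - m) * qn q (l + m))

/-- The value of `π_ε(a)` on the basis vector `|l,m⟩` of `H_h`, where `L = 2l`, `M = 2m`. -/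
def aVal (q ε : ℝ) (L M : ℤ) : Hh :=
  ((aC1 q ε (L/2 : ℝ) (M/2 : ℝ) : ℝ) : ℂ) • ket L (M + 2)
    + ((aC2 q (L/2 : ℝ) (M/2 : ℝ) : ℝ) : ℂ) • ket (L + 2) (M + 2)
    - ((aC3 q (L/2 : ℝ) (M/2 : ℝ) : ℝ) : ℂ) • ket (L - 2) (M + 2)

/-- The value of `π_ε(b)` on the basis vector `|l,m⟩` of `H_h`, where `L = 2l`, `M = 2m`. -/
def bVal (q ε : ℝ) (L M : ℤ) : Hh :=
  ((bC1 q ε (L/2 : ℝ) (M/2 : ℝ) : ℝ) : ℂ) • ket L M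
    - ((bC2 q (L/2 : ℝ) (M/2 : ℝ) : ℝ) : ℂ) • ket (L + 2) M
    - ((bC3 q (L/2 : ℝ) (M/2 : ℝ) : ℝ) : ℂ) • ket (L - 2) M

section QNumbers

variable {q : ℝ}

lemma qn_eq (q x : ℝ) : qn q x = (q ^ (-x) - q ^ x) / (q⁻¹ - q) := by
  rw [qn, ← neg_div_neg_eq, neg_sub, neg_sub]

lemma inv_sub_self_pos (hq0 : 0 < q) (hq1 : q < 1) : 0 < q⁻¹ - q := by
  have := (one_lt_inv₀ hq0).2 hq1
  linarith

lemma qn_nonneg (hq0 : 0 < q) (hq1 : q < 1) {x : ℝ} (hx : 0 ≤ x) : 0 ≤ qn q x := by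
  rw [qn_eq]
  refine div_nonneg (sub_nonneg.2 ?_) (inv_sub_self_pos hq0 hq1).le
  exact Real.rpow_le_rpow_of_exponent_ge hq0 hq1.le (by linarith)

lemma qn_le (hq0 : 0 < q) (hq1 : q < 1) (x : ℝ) : qn q x ≤ q ^ (-x) / (q⁻¹ - q) := by
  rw [qn_eq]
  have := inv_sub_self_pos hq0 hq1
  have := Real.rpow_pos_of_pos hq0 x
  gcongr
  linarith

lemma rpow_le_qn (hq0 : 0 < q) (hq1 : q < 1) {x : ℝ} (hx : 1 ≤ x) : q ^ (1 - x) ≤ qn q x := by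
  rw [qn_eq, le_div_iff₀ (inv_sub_self_pos hq0 hq1), mul_sub, ← Real.rpow_neg_one,
    ← Real.rpow_add hq0, ← Real.rpow_add_one hq0.ne']
  have := Real.rpow_le_rpow_of_exponent_ge hq0 hq1.le (show 1 - x + 1 ≤ x + 2 * (1 - x) by linarith)
  have h2 : q ^ x ≤ q ^ (1 - x + 1) :=
    Real.rpow_le_rpow_of_exponent_ge hq0 hq1.le (by linarith)
  have h3 : 1 - x + -1 = -x := by ring
  rw [h3]
  linarith

lemma qn_pos (hq0 : 0 < q) (hq1 : q < 1) {x : ℝ} (hx : 1 ≤ x) : 0 < qn q x :=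
  (Real.rpow_pos_of_pos hq0 _).trans_le (rpow_le_qn hq0 hq1 hx)

lemma inv_qn_le (hq0 : 0 < q) (hq1 : q < 1) {x : ℝ} (hx : 1 ≤ x) :
    (qn q x)⁻¹ ≤ q ^ (x - 1) := by
  rw [← neg_sub, Real.rpow_neg hq0.le]
  exact inv_anti₀ (Real.rpow_pos_of_pos hq0 _) (rpow_le_qn hq0 hq1 hx)

lemma qn_mul_qn_le (hq0 : 0 < q) (hq1 : q < 1) {x y : ℝ} (hy : 0 ≤ y) :
    qn q x * qn q y ≤ q ^ (-(x + y)) / (q⁻¹ - q) ^ 2 := by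
  have hd := inv_sub_self_pos hq0 hq1
  calc qn q x * qn q y ≤ q ^ (-x) / (q⁻¹ - q) * (q ^ (-y) / (q⁻¹ - q)) := by
        have := qn_nonneg hq0 hq1 hy
        gcongr <;> exact qn_le hq0 hq1 _
    _ = _ := by
        rw [neg_add, Real.rpow_add hq0, div_mul_div_comm, sq]

lemma sqrt_qn_mul_qn_le (hq0 : 0 < q) (hq1 : q < 1) {x y : ℝ} (hx : 0 ≤ x)
    (hy : x = 0 ∨ 0 ≤ y) :
    √(qn q x * qn q y) ≤ q ^ (-((x + y) / 2)) / (q⁻¹ - q) := by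
  have hd := inv_sub_self_pos hq0 hq1
  have hp := Real.rpow_pos_of_pos hq0 (-((x + y) / 2))
  rcases hy with rfl | hy
  · simp only [qn, neg_zero, sub_self, zero_div, zero_mul, Real.sqrt_zero]
    positivity
  · refine Real.sqrt_le_iff.2 ⟨by positivity, (qn_mul_qn_le hq0 hq1 hy).trans_eq ?_⟩
    rw [div_pow, ← Real.rpow_mul_natCast hq0.le]
    congr 2
    push_cast
    ring

lemma abs_weight_le (hq0 : 0 < q) (hq1 : q < 1) {a x y z : ℝ} (hx : 1 ≤ x) (hy : 0 ≤ y)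
    (hz : y = 0 ∨ 0 ≤ z) (hs : -1 ≤ a + x - 1 - (y + z) / 2) :
    |q ^ a / qn q x * √(qn q y * qn q z)| ≤ q⁻¹ / (q⁻¹ - q) := by
  have hd := inv_sub_self_pos hq0 hq1
  have hx0 := qn_pos hq0 hq1 hx
  have ha := Real.rpow_pos_of_pos hq0 a
  rw [abs_of_nonneg (by positivity), div_eq_mul_inv]
  calc q ^ a * (qn q x)⁻¹ * √(qn q y * qn q z)
      ≤ q ^ a * q ^ (x - 1) * (q ^ (-((y + z) / 2)) / (q⁻¹ - q)) := by
        gcongr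
        · exact inv_qn_le hq0 hq1 hx
        · exact sqrt_qn_mul_qn_le hq0 hq1 hy hz
    _ = q ^ (a + x - 1 - (y + z) / 2) / (q⁻¹ - q) := by
        rw [← mul_div_assoc, ← Real.rpow_add hq0, ← Real.rpow_add hq0]
        congr 2
        ring
    _ ≤ q⁻¹ / (q⁻¹ - q) := by
        gcongr
        rw [← Real.rpow_neg_one]
        exact Real.rpow_le_rpow_of_exponent_ge hq0 hq1.le hs

end QNumbers

section Coefficients

variable {q ε : ℝ}

lemma abs_aC1_le (hq0 : 0 < q) (hq1 : q < 1) (hε : |ε| = 1) {l m : ℝ} (hl : 1 / 2 ≤ l)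
    (hm : -l ≤ m) (hml : m ≤ l) :
    |aC1 q ε l m| ≤ (1 + q ^ 2) * (q⁻¹ / (q⁻¹ - q)) := by
  have h2 : (qn q (2 * l))⁻¹ ≤ 1 :=
    (inv_qn_le hq0 hq1 (by linarith)).trans
      (Real.rpow_le_one hq0.le hq1.le (by linarith))
  have h0 := qn_pos hq0 hq1 (x := 2 * l) (by linarith)
  have hw := abs_weight_le hq0 hq1 (a := m - 1 / 2) (x := 2 * l + 2) (y := l + m + 1) (z := l - m)
    (by linarith) (by linarith) (Or.inr (by linarith)) (by linarith)
  have he : aC1 q ε l m = ε * (1 + q ^ 2) * ((qn q (2 * l))⁻¹ *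
      (q ^ (m - 1 / 2) / qn q (2 * l + 2) * √(qn q (l + m + 1) * qn q (l - m)))) := by
    rw [aC1]
    field_simp
  rw [he, abs_mul, abs_mul, hε, one_mul, abs_of_pos (by positivity : 0 < 1 + q ^ 2), abs_mul,
    abs_of_pos (inv_pos.2 h0)]
  gcongr
  calc _ ≤ 1 * (q⁻¹ / (q⁻¹ - q)) := by gcongr
    _ = _ := one_mul _

lemma abs_aC2_le (hq0 : 0 < q) (hq1 : q < 1) {l m : ℝ} (hl : 1 / 2 ≤ l) (hm : -l ≤ m) :
    |aC2 q l m| ≤ q⁻¹ / (q⁻¹ - q) :=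
  abs_weight_le hq0 hq1 (by linarith) (by linarith) (Or.inr (by linarith)) (by linarith)

lemma abs_aC3_le (hq0 : 0 < q) (hq1 : q < 1) {l m : ℝ} (hl : 1 / 2 ≤ l) (hm : -l ≤ m)
    (hml : m = l ∨ m + 1 ≤ l) : |aC3 q l m| ≤ q⁻¹ / (q⁻¹ - q) :=
  abs_weight_le hq0 hq1 (by linarith) (by rcases hml with h | h <;> linarith)
    (hml.imp (fun h ↦ by linarith) (fun h ↦ by linarith)) (by linarith)

lemma abs_bC1_le (hq0 : 0 < q) (hq1 : q < 1) (hε : |ε| = 1) {l m : ℝ} (hl : 1 / 2 ≤ l)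
    (hm : -l ≤ m) (hml : m ≤ l) :
    |bC1 q ε l m| ≤ (1 + q ^ 2) / (q⁻¹ - q) ^ 2 := by
  have hd := inv_sub_self_pos hq0 hq1
  have h1 := qn_mul_qn_le hq0 hq1 (x := l - m + 1) (y := l + m) (by linarith)
  have h2 := qn_mul_qn_le hq0 hq1 (x := l - m) (y := l + m + 1) (by linarith)
  have n1 := qn_nonneg hq0 hq1 (x := l - m + 1) (by linarith)
  have n2 := qn_nonneg hq0 hq1 (x := l + m) (by linarith)
  have n3 := qn_nonneg hq0 hq1 (x := l - m) (by linarith)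
  have n4 := qn_nonneg hq0 hq1 (x := l + m + 1) (by linarith)
  have p1 := qn_pos hq0 hq1 (x := 2 * l) (by linarith)
  have p2 := qn_pos hq0 hq1 (x := 2 * l + 2) (by linarith)
  have e1 : -(l - m + 1 + (l + m)) = -(2 * l + 1) := by ring
  have e2 : -(l - m + (l + m + 1)) = -(2 * l + 1) := by ring
  rw [e1] at h1
  rw [e2] at h2
  have hnum : |qn q (l - m + 1) * qn q (l + m) - q ^ 2 * (qn q (l - m) * qn q (l + m + 1))| ≤
      (1 + q ^ 2) * (q ^ (-(2 * l + 1)) / (q⁻¹ - q) ^ 2) := by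
    refine (abs_sub _ _).trans ?_
    rw [abs_of_nonneg (by positivity), abs_of_nonneg (by positivity), add_mul, one_mul]
    gcongr
  rw [bC1, abs_mul, hε, one_mul, abs_div, abs_of_pos (mul_pos p1 p2), div_eq_mul_inv, mul_inv]
  have hp := Real.rpow_pos_of_pos hq0 (-(2 * l + 1))
  calc _ ≤ (1 + q ^ 2) * (q ^ (-(2 * l + 1)) / (q⁻¹ - q) ^ 2) *
        (q ^ (2 * l - 1) * q ^ (2 * l + 2 - 1)) := by
        gcongr
        · exact inv_qn_le hq0 hq1 (by linarith)
        · exact inv_qn_le hq0 hq1 (by linarith)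
    _ = (1 + q ^ 2) * (q ^ (2 * l - 1)) / (q⁻¹ - q) ^ 2 := by
        have : q ^ (2 * l + 2 - 1) * q ^ (-(2 * l + 1)) = 1 := by
          rw [← Real.rpow_add hq0, show 2 * l + 2 - 1 + -(2 * l + 1) = 0 by ring, Real.rpow_zero]
        linear_combination (1 + q ^ 2) * (q ^ (2 * l - 1)) / (q⁻¹ - q) ^ 2 * this
    _ ≤ (1 + q ^ 2) * 1 / (q⁻¹ - q) ^ 2 := by
        gcongr
        exact Real.rpow_le_one hq0.le hq1.le (by linarith)
    _ = _ := by rw [mul_one]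

lemma abs_bC2_le (hq0 : 0 < q) (hq1 : q < 1) {l m : ℝ} (hl : 1 / 2 ≤ l) (hm : -l ≤ m)
    (hml : m ≤ l) : |bC2 q l m| ≤ q⁻¹ / (q⁻¹ - q) :=
  abs_weight_le hq0 hq1 (by linarith) (by linarith) (Or.inr (by linarith)) (by linarith)

lemma abs_bC3_le (hq0 : 0 < q) (hq1 : q < 1) {l m : ℝ} (hl : 1 / 2 ≤ l) (hm : -l ≤ m)
    (hml : m ≤ l) : |bC3 q l m| ≤ q⁻¹ / (q⁻¹ - q) :=
  abs_weight_le hq0 hq1 (by linarith) (by linarith) (Or.inr (by linarith)) (by linarith)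

lemma bC2_eq_bC3 (q l m : ℝ) : bC2 q l m = bC3 q (l + 1) m := by
  rw [bC2, bC3]
  ring_nf

lemma Idx.half_le (p : Idx) : (1 / 2 : ℝ) ≤ (p.1.1 / 2 : ℝ) := by
  have : (1 : ℝ) ≤ p.1.1 := by exact_mod_cast p.2.1
  linarith

lemma Idx.neg_le (p : Idx) : -(p.1.1 / 2 : ℝ) ≤ (p.1.2 / 2 : ℝ) := by
  have : (-p.1.1 : ℝ) ≤ p.1.2 := by exact_mod_cast (abs_le.1 p.2.2.2.2).1
  linarith

lemma Idx.le (p : Idx) : (p.1.2 / 2 : ℝ) ≤ (p.1.1 / 2 : ℝ) := by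
  have : (p.1.2 : ℝ) ≤ p.1.1 := by exact_mod_cast (abs_le.1 p.2.2.2.2).2
  linarith

lemma Idx.eq_or_add_one_le (p : Idx) :
    (p.1.2 / 2 : ℝ) = (p.1.1 / 2 : ℝ) ∨ (p.1.2 / 2 : ℝ) + 1 ≤ (p.1.1 / 2 : ℝ) := by
  obtain ⟨⟨L, M⟩, -, ⟨a, ha⟩, ⟨b, hb⟩, hLM⟩ := p
  dsimp only at *
  have hle := (abs_le.1 hLM).2
  have h : M = L ∨ M + 2 ≤ L := by omega
  refine h.imp (fun h ↦ by rw [h]) (fun h ↦ ?_)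
  have : (M + 2 : ℝ) ≤ L := by exact_mod_cast h
  linarith

end Coefficients

section Operators

lemma ebs_apply (p r : Idx) : (ebs p : Idx → ℂ) r = if r = p then 1 else 0 := by
  simp only [ebs, lp.coeFn_single, Pi.single_apply]

lemma ket_apply (L M : ℤ) (r : Idx) : (ket L M : Idx → ℂ) r = if r.1 = (L, M) then 1 else 0 := by
  by_cases h : IdxP (L, M)
  · rw [ket, dif_pos h, ← ebs, ebs_apply]
    simp only [Subtype.ext_iff]
  · rw [ket, dif_neg h, lp.coeFn_zero, Pi.zero_apply, if_neg]
    exact fun hr ↦ h (hr ▸ r.2)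

lemma topologicalClosure_span_ebs :
    (Submodule.span ℂ (Set.range ebs) : Submodule ℂ Hh).topologicalClosure = ⊤ := by
  let b : HilbertBasis Idx ℂ Hh := HilbertBasis.ofRepr (LinearIsometryEquiv.refl ℂ Hh)
  have hb : (b : Idx → Hh) = ebs := by
    funext p
    rw [← HilbertBasis.repr_symm_single]
    change lp.single 2 p 1 = lp.single 2 p 1
    congr!
  rw [← hb]
  exact b.dense_span

lemma dense_span_ebs : Dense ((Submodule.span ℂ (Set.range ebs) : Submodule ℂ Hh) : Set Hh) :=
  Submodule.dense_iff_topologicalClosure_eq_top.2 topologicalClosure_span_ebs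

/-- The coordinates of the image of `x` under the weighted shift by `s` with weights `w`. -/
def shiftFun (w : Idx → ℂ) (s : ℤ × ℤ) (x : Idx → ℂ) (r : Idx) : ℂ :=
  if h : IdxP (r.1 - s) then w ⟨r.1 - s, h⟩ * x ⟨r.1 - s, h⟩ else 0

lemma sum_norm_shiftFun_le {w : Idx → ℂ} {C : ℝ} (hw : ∀ p, ‖w p‖ ≤ C) (s : ℤ × ℤ) (x : Hh)
    (t : Finset Idx) :
    ∑ r ∈ t, ‖shiftFun w s x r‖ ^ (2 : ℝ≥0∞).toReal ≤ (C * ‖x‖) ^ (2 : ℝ≥0∞).toReal := by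
  classical
  let p₀ : Idx := ⟨(1, 1), by simp [IdxP]⟩
  have hC : 0 ≤ C := (norm_nonneg _).trans (hw p₀)
  let g : Idx → Idx := fun r ↦ if h : IdxP (r.1 - s) then ⟨r.1 - s, h⟩ else p₀
  have hg : ∀ r (h : IdxP (r.1 - s)), g r = ⟨r.1 - s, h⟩ := fun r h ↦ dif_pos h
  have hinj : Set.InjOn g (t.filter fun r ↦ IdxP (r.1 - s)) := by
    intro r hr r' hr' h
    simp only [Finset.coe_filter, Set.mem_ofPred_eq] at hr hr'
    rw [hg r hr.2, hg r' hr'.2, Subtype.mk.injEq, sub_left_inj] at h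
    exact Subtype.ext h
  calc ∑ r ∈ t, ‖shiftFun w s x r‖ ^ (2 : ℝ≥0∞).toReal
      = ∑ r ∈ t with IdxP (r.1 - s), ‖shiftFun w s x r‖ ^ (2 : ℝ≥0∞).toReal := by
        refine (Finset.sum_filter_of_ne fun r _ hr ↦ ?_).symm
        by_contra h
        exact hr (by simp [shiftFun, dif_neg h])
    _ ≤ ∑ r ∈ t with IdxP (r.1 - s),
          C ^ (2 : ℝ≥0∞).toReal * ‖x (g r)‖ ^ (2 : ℝ≥0∞).toReal := by
        refine Finset.sum_le_sum fun r hr ↦ ?_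
        have h := (Finset.mem_filter.1 hr).2
        rw [shiftFun, dif_pos h, hg r h, norm_mul, ← Real.mul_rpow hC (norm_nonneg _)]
        gcongr
        exact hw _
    _ = C ^ (2 : ℝ≥0∞).toReal *
          ∑ p ∈ (t.filter fun r ↦ IdxP (r.1 - s)).image g, ‖x p‖ ^ (2 : ℝ≥0∞).toReal := by
        rw [Finset.sum_image hinj, Finset.mul_sum]
    _ ≤ (C * ‖x‖) ^ (2 : ℝ≥0∞).toReal := by
        rw [Real.mul_rpow hC (norm_nonneg _)]
        gcongr
        exact lp.sum_rpow_le_norm_rpow (by simp) x _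

lemma exists_weightedShift {w : Idx → ℂ} {C : ℝ} (hw : ∀ p, ‖w p‖ ≤ C) (s : ℤ × ℤ) :
    ∃ T : Hh →L[ℂ] Hh, ∀ p : Idx, T (ebs p) = w p • ket (p.1.1 + s.1) (p.1.2 + s.2) := by
  have hC : 0 ≤ C := (norm_nonneg _).trans (hw ⟨(1, 1), by simp [IdxP]⟩)
  let T₀ : Hh →ₗ[ℂ] Hh :=
    { toFun := fun x ↦ ⟨shiftFun w s x, memℓp_gen' (sum_norm_shiftFun_le hw s x)⟩
      map_add' := fun x y ↦ by
        ext r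
        simp only [shiftFun, lp.coeFn_add, Pi.add_apply]
        split_ifs
        · ring
        · simp
      map_smul' := fun c x ↦ by
        ext r
        simp only [shiftFun, lp.coeFn_smul, Pi.smul_apply, smul_eq_mul, RingHom.id_apply]
        split_ifs
        · ring
        · simp }
  refine ⟨T₀.mkContinuous C fun x ↦ ?_, fun p ↦ ?_⟩
  · exact lp.norm_le_of_forall_sum_le (by simp) (by positivity) (sum_norm_shiftFun_le hw s x)
  · ext r
    change shiftFun w s (ebs p) r = _
    rw [lp.coeFn_smul, Pi.smul_apply, ket_apply, smul_eq_mul, shiftFun]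
    have hiff : r.1 = (p.1.1 + s.1, p.1.2 + s.2) ↔ r.1 - s = p.1 := sub_eq_iff_eq_add.symm
    by_cases hr : r.1 - s = p.1
    · have h : IdxP (r.1 - s) := hr ▸ p.2
      have hp : (⟨r.1 - s, h⟩ : Idx) = p := Subtype.ext hr
      rw [dif_pos h, if_pos (hiff.2 hr), hp, ebs_apply, if_pos rfl]
    · rw [if_neg (mt hiff.1 hr), mul_zero]
      split_ifs with h
      · rw [ebs_apply, if_neg (fun hp ↦ hr (congrArg Subtype.val hp)), mul_zero]
      · rfl

lemma isSelfAdjoint_of_matrix_symm {B : Hh →L[ℂ] Hh}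
    (h : ∀ p r : Idx, conj ((B (ebs r) : Idx → ℂ) p) = (B (ebs p) : Idx → ℂ) r) :
    IsSelfAdjoint B := by
  rw [ContinuousLinearMap.isSelfAdjoint_iff']
  refine ContinuousLinearMap.ext_on dense_span_ebs ?_
  rintro _ ⟨p, rfl⟩
  ext r
  have hcoord : ∀ (y : Hh) (r : Idx), (y : Idx → ℂ) r = ⟪ebs r, y⟫_ℂ := fun y r ↦ by
    rw [ebs, lp.inner_single_left]
    simp
  rw [hcoord, ContinuousLinearMap.adjoint_inner_right, ← inner_conj_symm, ← hcoord, h]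

lemma conj_bVal_apply (q ε : ℝ) (p r : Idx) :
    conj ((bVal q ε r.1.1 r.1.2 : Idx → ℂ) p) = (bVal q ε p.1.1 p.1.2 : Idx → ℂ) r := by
  obtain ⟨⟨L, M⟩, hp⟩ := p
  obtain ⟨⟨L', M'⟩, hr⟩ := r
  simp only [bVal, lp.coeFn_sub, lp.coeFn_smul, Pi.sub_apply, Pi.smul_apply, ket_apply,
    smul_eq_mul, map_sub, map_mul, Complex.conj_ofReal, Prod.mk.injEq]
  by_cases hM : M = M'
  · subst hM
    by_cases h0 : L = L'
    · subst h0
      simp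
    by_cases h1 : L = L' + 2
    · subst h1
      have : ((L' : ℝ) + 2) / 2 = L' / 2 + 1 := by ring
      simp [bC2_eq_bC3, this, show ¬ L' = L' + 2 + 2 by omega, show ¬ L' + 2 = L' - 2 by omega]
    by_cases h2 : L = L' - 2
    · subst h2
      have : ((L' : ℝ) - 2) / 2 + 1 = L' / 2 := by ring
      simp [bC2_eq_bC3, this, show ¬ L' = L' - 2 - 2 by omega, show ¬ L' - 2 = L' + 2 by omega,
        show ¬ L' = L' - 2 by omega]
    · simp [h0, h1, h2, Ne.symm h0, show ¬ L' = L + 2 by omega, show ¬ L' = L - 2 by omega]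
  · simp [hM, Ne.symm hM]

end Operators

/-- For each sign `ε ∈ {+, -}`, the operators `π_ε(a)` and `π_ε(b)`, defined on
the dense span of the orthonormal basis of `H_h`, extend to bounded linear operators on `H_h`;
moreover the bounded extension of `π_ε(b)` is self-adjoint. -/
theorem statement0 (q : ℝ) (hq0 : 0 < q) (hq1 : q < 1) (ε : ℝ) (hε : ε = 1 ∨ ε = -1) :
    Dense ((Submodule.span ℂ (Set.range ebs) : Submodule ℂ Hh) : Set Hh) ∧
    (∃ A : Hh →L[ℂ] Hh, ∀ p : Idx, A (ebs p) = aVal q ε p.1.1 p.1.2) ∧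
    (∃ B : Hh →L[ℂ] Hh, (∀ p : Idx, B (ebs p) = bVal q ε p.1.1 p.1.2) ∧ IsSelfAdjoint B) := by
  have hε' : |ε| = 1 := by rcases hε with rfl | rfl <;> simp
  refine ⟨dense_span_ebs, ?_, ?_⟩
  · obtain ⟨T₁, h₁⟩ := exists_weightedShift
      (w := fun p ↦ ((aC1 q ε (p.1.1 / 2 : ℝ) (p.1.2 / 2 : ℝ) : ℝ) : ℂ))
      (fun p ↦ (Complex.norm_real _).trans_le
        (abs_aC1_le hq0 hq1 hε' p.half_le p.neg_le p.le)) (0, 2)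
    obtain ⟨T₂, h₂⟩ := exists_weightedShift
      (w := fun p ↦ ((aC2 q (p.1.1 / 2 : ℝ) (p.1.2 / 2 : ℝ) : ℝ) : ℂ))
      (fun p ↦ (Complex.norm_real _).trans_le
        (abs_aC2_le hq0 hq1 p.half_le p.neg_le)) (2, 2)
    obtain ⟨T₃, h₃⟩ := exists_weightedShift
      (w := fun p ↦ ((aC3 q (p.1.1 / 2 : ℝ) (p.1.2 / 2 : ℝ) : ℝ) : ℂ))
      (fun p ↦ (Complex.norm_real _).trans_le
        (abs_aC3_le hq0 hq1 p.half_le p.neg_le p.eq_or_add_one_le)) (-2, 2)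
    refine ⟨T₁ + T₂ - T₃, fun p ↦ ?_⟩
    simp only [sub_apply, add_apply, h₁, h₂, h₃, aVal,
      add_zero, ← sub_eq_add_neg]
  · obtain ⟨T₁, h₁⟩ := exists_weightedShift
      (w := fun p ↦ ((bC1 q ε (p.1.1 / 2 : ℝ) (p.1.2 / 2 : ℝ) : ℝ) : ℂ))
      (fun p ↦ (Complex.norm_real _).trans_le
        (abs_bC1_le hq0 hq1 hε' p.half_le p.neg_le p.le)) (0, 0)
    obtain ⟨T₂, h₂⟩ := exists_weightedShift
      (w := fun p ↦ ((bC2 q (p.1.1 / 2 : ℝ) (p.1.2 / 2 : ℝ) : ℝ) : ℂ))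
      (fun p ↦ (Complex.norm_real _).trans_le
        (abs_bC2_le hq0 hq1 p.half_le p.neg_le p.le)) (2, 0)
    obtain ⟨T₃, h₃⟩ := exists_weightedShift
      (w := fun p ↦ ((bC3 q (p.1.1 / 2 : ℝ) (p.1.2 / 2 : ℝ) : ℝ) : ℂ))
      (fun p ↦ (Complex.norm_real _).trans_le
        (abs_bC3_le hq0 hq1 p.half_le p.neg_le p.le)) (-2, 0)
    have hB : ∀ p : Idx, (T₁ - T₂ - T₃) (ebs p) = bVal q ε p.1.1 p.1.2 := fun p ↦ by
      simp only [sub_apply, h₁, h₂, h₃, bVal, add_zero, ← sub_eq_add_neg]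
    refine ⟨T₁ - T₂ - T₃, hB, isSelfAdjoint_of_matrix_symm fun p r ↦ ?_⟩
    rw [hB, hB, conj_bVal_apply]
end
end

section
/- For each sign ε ∈ {+,−}, writing A = π_ε(a) and B = π_ε(b) for the bounded extensions, the defining relations of the equatorial Podleś sphere hold: B A = q² A B, A* B = q² B A*, A* A + B² = 1, and q² A A* + q^{−2} B² = q² (as identities of bounded operators on H_h, where A* denotes the Hilbert-space adjoint of A). -/
noncomputable section

open scoped ComplexConjugate ENNReal InnerProductSpace

/-! ### The basis in the coordinates `j = l + m`, `k = l - m` -/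

/-- The basis vector `|l,m⟩` with `j = l + m` and `k = l - m`; zero if the index is invalid. -/
def ejk (j k : ℤ) : Hh := ket (j + k) (j - k)

lemma idxP_iff (j k : ℤ) : IdxP (j + k, j - k) ↔ 0 ≤ j ∧ 0 ≤ k ∧ Odd (j + k) := by
  simp only [IdxP, abs_le, Int.odd_iff]
  omega

lemma ejk_of_valid {j k : ℤ} (h : IdxP (j + k, j - k)) : ejk j k = ebs ⟨(j + k, j - k), h⟩ := by
  simp [ejk, ket, ebs, h]

lemma ejk_of_not_valid {j k : ℤ} (h : ¬ IdxP (j + k, j - k)) : ejk j k = 0 := by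
  simp [ejk, ket, h]

lemma ket_eq_ejk {L M : ℤ} (j k : ℤ) (hL : L = j + k) (hM : M = j - k) :
    ket L M = ejk j k := by
  subst hL hM; rfl

lemma exists_ejk (p : Idx) : ∃ j k : ℤ, 0 ≤ j ∧ 0 ≤ k ∧ Odd (j + k) ∧
    p.1.1 = j + k ∧ p.1.2 = j - k ∧ ebs p = ejk j k := by
  obtain ⟨⟨L, M⟩, hp⟩ := p
  obtain ⟨j, hj⟩ : ∃ j, L + M = 2 * j := by
    obtain ⟨-, ⟨a, ha⟩, ⟨b, hb⟩, -⟩ := hp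
    exact ⟨a + b + 1, by simp only at ha hb; omega⟩
  obtain ⟨k, rfl⟩ : ∃ k, L = j + k := ⟨L - j, by ring⟩
  obtain rfl : M = j - k := by omega
  have hv := (idxP_iff j k).1 hp
  exact ⟨j, k, hv.1, hv.2.1, hv.2.2, rfl, rfl, (ejk_of_valid hp).symm⟩

lemma inner_ejk (j k j' k' : ℤ) (h : IdxP (j + k, j - k)) :
    ⟪ejk j k, ejk j' k'⟫_ℂ = if j = j' ∧ k = k' then 1 else 0 := by
  by_cases h' : IdxP (j' + k', j' - k')
  · rw [ejk_of_valid h, ejk_of_valid h', ebs, ebs, lp.inner_single_left, lp.single_apply]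
    by_cases hjk : j = j' ∧ k = k'
    · obtain ⟨rfl, rfl⟩ := hjk
      simp
    · rw [if_neg hjk, Pi.single_eq_of_ne, inner_zero_right]
      intro hc
      simp only [Subtype.mk.injEq, Prod.mk.injEq] at hc
      omega
  · rw [ejk_of_not_valid h', inner_zero_right, if_neg]
    rintro ⟨rfl, rfl⟩
    exact h' h

lemma clm_ext_ebs {S T : Hh →L[ℂ] Hh} (h : ∀ p, S (ebs p) = T (ebs p)) : S = T := by
  refine lp.ext_continuousLinearMap (ENNReal.ofNat_ne_top (n := 2)) fun i => ?_
  ext1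
  exact h i

lemma vec_ext_ebs {v w : Hh} (h : ∀ p, ⟪ebs p, v⟫_ℂ = ⟪ebs p, w⟫_ℂ) : v = w := by
  ext p
  simpa [ebs, lp.inner_single_left] using h p

/-! ### `q`-integers and the coefficients, with `q = r ^ 2` -/

/-- The `q`-integer `[n]` for `q = r ^ 2`. -/
def qint (r : ℝ) (n : ℤ) : ℝ := (r ^ (2 * n) - r ^ (-(2 * n))) / (r ^ 2 - (r ^ 2)⁻¹)

/-- The square root of a `q`-integer, equal to `0` for negative integers. -/
def sqn (r : ℝ) (n : ℤ) : ℝ := √(qint r n)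

/-- `aC1` in the coordinates `j, k`. -/
def a1 (r ε : ℝ) (j k : ℤ) : ℝ :=
  ε * (1 + r ^ 4) * r ^ (j - k - 1) / (qint r (j + k) * qint r (j + k + 2)) *
    (sqn r (j + 1) * sqn r k)

/-- `aC2` in the coordinates `j, k`. -/
def a2 (r : ℝ) (j k : ℤ) : ℝ :=
  r ^ (-(2 * k) - 1) / qint r (j + k + 2) * (sqn r (j + 1) * sqn r (j + 2))

/-- `aC3` in the coordinates `j, k`. -/
def a3 (r : ℝ) (j k : ℤ) : ℝ :=
  r ^ (2 * j + 1) / qint r (j + k) * (sqn r k * sqn r (k - 1))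

/-- `bC1` in the coordinates `j, k`. -/
def b1 (r ε : ℝ) (j k : ℤ) : ℝ :=
  ε * (qint r (k + 1) * qint r j - r ^ 4 * (qint r k * qint r (j + 1))) /
    (qint r (j + k) * qint r (j + k + 2))

/-- `bC2` in the coordinates `j, k`. -/
def b2 (r : ℝ) (j k : ℤ) : ℝ :=
  r ^ (j - k + 2) / qint r (j + k + 2) * (sqn r (k + 1) * sqn r (j + 1))

/-- `bC3` in the coordinates `j, k`. -/
def b3 (r : ℝ) (j k : ℤ) : ℝ :=
  r ^ (j - k + 2) / qint r (j + k) * (sqn r k * sqn r j)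

section Coefficients

variable {r : ℝ}

lemma rpow_sq_eq_zpow (hr0 : 0 < r) {x : ℝ} {n : ℤ} (h : 2 * x = n) :
    (r ^ 2) ^ x = r ^ n := by
  rw [← Real.rpow_natCast, ← Real.rpow_mul hr0.le, ← Real.rpow_intCast, ← h]
  norm_num

lemma qn_eq_qint (hr0 : 0 < r) {x : ℝ} {n : ℤ} (h : x = n) : qn (r ^ 2) x = qint r n := by
  rw [qn, qint, rpow_sq_eq_zpow hr0 (n := 2 * n) (by rw [h]; push_cast; ring),
    rpow_sq_eq_zpow hr0 (n := -(2 * n)) (by rw [h]; push_cast; ring)]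

lemma sq_sub_inv_neg (hr0 : 0 < r) (hr1 : r < 1) : r ^ 2 - (r ^ 2)⁻¹ < 0 := by
  have h2 : r ^ 2 < 1 := by nlinarith
  have := (one_lt_inv₀ (by positivity : 0 < r ^ 2)).2 h2
  linarith

lemma qint_zero : qint r 0 = 0 := by simp [qint]

lemma qint_pos (hr0 : 0 < r) (hr1 : r < 1) {n : ℤ} (hn : 0 < n) : 0 < qint r n := by
  refine div_pos_of_neg_of_neg ?_ (sq_sub_inv_neg hr0 hr1)
  have := zpow_lt_zpow_right_of_lt_one₀ hr0 hr1 (show -(2 * n) < 2 * n by omega)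
  linarith

lemma qint_neg (n : ℤ) : qint r (-n) = - qint r n := by
  rw [qint, qint, ← neg_div]
  congr 1
  rw [mul_neg, neg_neg]
  ring

lemma qint_nonneg (hr0 : 0 < r) (hr1 : r < 1) {n : ℤ} (hn : 0 ≤ n) : 0 ≤ qint r n := by
  rcases hn.eq_or_lt with rfl | hn
  · rw [qint_zero]
  · exact (qint_pos hr0 hr1 hn).le

lemma qint_ne_zero (hr0 : 0 < r) (hr1 : r < 1) {n : ℤ} (hn : n ≠ 0) : qint r n ≠ 0 := by
  rcases hn.lt_or_gt with h | h
  · have := qint_pos hr0 hr1 (n := -n) (by omega)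
    rw [qint_neg] at this
    exact (by linarith : qint r n < 0).ne
  · exact (qint_pos hr0 hr1 h).ne'

lemma sqn_sq (hr0 : 0 < r) (hr1 : r < 1) {n : ℤ} (hn : 0 ≤ n) : sqn r n ^ 2 = qint r n :=
  Real.sq_sqrt (qint_nonneg hr0 hr1 hn)

lemma sqn_of_nonpos (hr0 : 0 < r) (hr1 : r < 1) {n : ℤ} (hn : n ≤ 0) : sqn r n = 0 := by
  refine Real.sqrt_eq_zero_of_nonpos ?_
  have := qint_nonneg hr0 hr1 (n := -n) (by omega)
  rw [qint_neg] at this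
  linarith

lemma sqrt_qn_mul (hr0 : 0 < r) (hr1 : r < 1) {x y : ℝ} {m n : ℤ} (hm : 0 ≤ m)
    (hx : x = m) (hy : y = n) : √(qn (r ^ 2) x * qn (r ^ 2) y) = sqn r m * sqn r n := by
  rw [qn_eq_qint hr0 hx, qn_eq_qint hr0 hy, Real.sqrt_mul (qint_nonneg hr0 hr1 hm), sqn, sqn]

variable (ε : ℝ) {j k : ℤ}

lemma aC1_eq (hr0 : 0 < r) (hr1 : r < 1) (hj : 0 ≤ j) :
    aC1 (r ^ 2) ε (((j + k : ℤ) : ℝ) / 2) (((j - k : ℤ) : ℝ) / 2) = a1 r ε j k := by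
  rw [aC1, sqrt_qn_mul hr0 hr1 (m := j + 1) (n := k) (by omega) (by push_cast; ring)
    (by push_cast; ring), rpow_sq_eq_zpow hr0 (n := j - k - 1) (by push_cast; ring),
    qn_eq_qint hr0 (n := j + k) (by push_cast; ring),
    qn_eq_qint hr0 (n := j + k + 2) (by push_cast; ring), a1]
  ring

lemma aC2_eq (hr0 : 0 < r) (hr1 : r < 1) (hj : 0 ≤ j) :
    aC2 (r ^ 2) (((j + k : ℤ) : ℝ) / 2) (((j - k : ℤ) : ℝ) / 2) = a2 r j k := by
  rw [aC2, sqrt_qn_mul hr0 hr1 (m := j + 1) (n := j + 2) (by omega) (by push_cast; ring)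
    (by push_cast; ring), rpow_sq_eq_zpow hr0 (n := -(2 * k) - 1) (by push_cast; ring),
    qn_eq_qint hr0 (n := j + k + 2) (by push_cast; ring), a2]

lemma aC3_eq (hr0 : 0 < r) (hr1 : r < 1) (hk : 0 ≤ k) :
    aC3 (r ^ 2) (((j + k : ℤ) : ℝ) / 2) (((j - k : ℤ) : ℝ) / 2) = a3 r j k := by
  rw [aC3, sqrt_qn_mul hr0 hr1 (m := k) (n := k - 1) (by omega) (by push_cast; ring)
    (by push_cast; ring), rpow_sq_eq_zpow hr0 (n := 2 * j + 1) (by push_cast; ring),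
    qn_eq_qint hr0 (n := j + k) (by push_cast; ring), a3]

lemma bC1_eq (hr0 : 0 < r) :
    bC1 (r ^ 2) ε (((j + k : ℤ) : ℝ) / 2) (((j - k : ℤ) : ℝ) / 2) = b1 r ε j k := by
  rw [bC1, qn_eq_qint hr0 (n := k + 1) (by push_cast; ring),
    qn_eq_qint hr0 (n := j) (by push_cast; ring), qn_eq_qint hr0 (n := k) (by push_cast; ring),
    qn_eq_qint hr0 (n := j + 1) (by push_cast; ring),
    qn_eq_qint hr0 (n := j + k) (by push_cast; ring),
    qn_eq_qint hr0 (n := j + k + 2) (by push_cast; ring), b1]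
  ring

lemma bC2_eq (hr0 : 0 < r) (hr1 : r < 1) (hk : 0 ≤ k) :
    bC2 (r ^ 2) (((j + k : ℤ) : ℝ) / 2) (((j - k : ℤ) : ℝ) / 2) = b2 r j k := by
  rw [bC2, sqrt_qn_mul hr0 hr1 (m := k + 1) (n := j + 1) (by omega) (by push_cast; ring)
    (by push_cast; ring), rpow_sq_eq_zpow hr0 (n := j - k + 2) (by push_cast; ring),
    qn_eq_qint hr0 (n := j + k + 2) (by push_cast; ring), b2]

lemma bC3_eq (hr0 : 0 < r) (hr1 : r < 1) (hk : 0 ≤ k) :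
    bC3 (r ^ 2) (((j + k : ℤ) : ℝ) / 2) (((j - k : ℤ) : ℝ) / 2) = b3 r j k := by
  rw [bC3, sqrt_qn_mul hr0 hr1 (m := k) (n := j) (by omega) (by push_cast; ring)
    (by push_cast; ring), rpow_sq_eq_zpow hr0 (n := j - k + 2) (by push_cast; ring),
    qn_eq_qint hr0 (n := j + k) (by push_cast; ring), b3]

end Coefficients

section Operators

variable {r ε : ℝ} {A B : Hh →L[ℂ] Hh}

lemma apply_a_ejk (hr0 : 0 < r) (hr1 : r < 1)
    (hA : ∀ p : Idx, A (ebs p) = aVal (r ^ 2) ε p.1.1 p.1.2) (j k : ℤ) :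
    A (ejk j k) = (a1 r ε j k : ℂ) • ejk (j + 1) (k - 1) + (a2 r j k : ℂ) • ejk (j + 2) k
      - (a3 r j k : ℂ) • ejk j (k - 2) := by
  by_cases h : IdxP (j + k, j - k)
  · obtain ⟨hj, hk, -⟩ := (idxP_iff j k).1 h
    rw [ejk_of_valid h, hA, aVal, aC1_eq ε hr0 hr1 hj, aC2_eq hr0 hr1 hj, aC3_eq hr0 hr1 hk,
      ket_eq_ejk (j + 1) (k - 1) (by ring) (by ring), ket_eq_ejk (j + 2) k (by ring) (by ring),
      ket_eq_ejk j (k - 2) (by ring) (by ring)]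
  · have h1 : a1 r ε j k = 0 ∨ ejk (j + 1) (k - 1) = 0 := by
      by_cases h' : IdxP (j + 1 + (k - 1), j + 1 - (k - 1))
      · left
        rw [idxP_iff] at h h'
        rw [a1, sqn_of_nonpos hr0 hr1 (n := j + 1) (by grind)]
        simp
      · exact .inr (ejk_of_not_valid h')
    have h2 : a2 r j k = 0 ∨ ejk (j + 2) k = 0 := by
      by_cases h' : IdxP (j + 2 + k, j + 2 - k)
      · left
        rw [idxP_iff] at h h'
        rw [a2, sqn_of_nonpos hr0 hr1 (n := j + 1) (by grind)]
        simp
      · exact .inr (ejk_of_not_valid h')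
    have h3 : a3 r j k = 0 ∨ ejk j (k - 2) = 0 := by
      by_cases h' : IdxP (j + (k - 2), j - (k - 2))
      · exfalso
        rw [idxP_iff] at h h'
        grind
      · exact .inr (ejk_of_not_valid h')
    rw [ejk_of_not_valid h, map_zero]
    rcases h1 with h1 | h1 <;> rcases h2 with h2 | h2 <;> rcases h3 with h3 | h3 <;>
      simp [h1, h2, h3]

lemma apply_b_ejk (hr0 : 0 < r) (hr1 : r < 1)
    (hB : ∀ p : Idx, B (ebs p) = bVal (r ^ 2) ε p.1.1 p.1.2) (j k : ℤ) :
    B (ejk j k) = (b1 r ε j k : ℂ) • ejk j k - (b2 r j k : ℂ) • ejk (j + 1) (k + 1)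
      - (b3 r j k : ℂ) • ejk (j - 1) (k - 1) := by
  by_cases h : IdxP (j + k, j - k)
  · obtain ⟨hj, hk, -⟩ := (idxP_iff j k).1 h
    rw [ejk_of_valid h, hB, bVal, bC1_eq ε hr0, bC2_eq hr0 hr1 hk, bC3_eq hr0 hr1 hk,
      ket_eq_ejk j k (by ring) (by ring), ket_eq_ejk (j + 1) (k + 1) (by ring) (by ring),
      ket_eq_ejk (j - 1) (k - 1) (by ring) (by ring), ejk_of_valid h]
  · have h2 : b2 r j k = 0 ∨ ejk (j + 1) (k + 1) = 0 := by
      by_cases h' : IdxP (j + 1 + (k + 1), j + 1 - (k + 1))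
      · left
        rw [idxP_iff] at h h'
        obtain hj | hk : j + 1 ≤ 0 ∨ k + 1 ≤ 0 := by grind
        · simp [b2, sqn_of_nonpos hr0 hr1 hj]
        · simp [b2, sqn_of_nonpos hr0 hr1 hk]
      · exact .inr (ejk_of_not_valid h')
    have h3 : ejk (j - 1) (k - 1) = 0 := by
      refine ejk_of_not_valid fun h' => ?_
      rw [idxP_iff] at h h'
      grind
    rw [ejk_of_not_valid h, map_zero, h3]
    rcases h2 with h2 | h2 <;> simp [h2]

lemma inner_smul_ejk_shift (c : ℝ) {j k j' k' : ℤ} (u v : ℤ)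
    (h : IdxP (j + k, j - k)) (h' : IdxP (j' + k', j' - k')) (f : ℤ → ℤ → ℝ) (hc : c = f j' k') :
    ⟪(c : ℂ) • ejk (j' + u) (k' + v), ejk j k⟫_ℂ =
      ⟪ejk j' k', (f (j - u) (k - v) : ℂ) • ejk (j - u) (k - v)⟫_ℂ := by
  rw [inner_smul_left, inner_smul_right, inner_ejk _ _ _ _ h', ← inner_conj_symm,
    inner_ejk _ _ _ _ h]
  by_cases hjk : j = j' + u ∧ k = k' + v
  · obtain ⟨rfl, rfl⟩ := hjk
    simp [hc]
  · rw [if_neg hjk, if_neg (by omega)]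
    simp

lemma adjoint_a_ejk (hr0 : 0 < r) (hr1 : r < 1)
    (hA : ∀ p : Idx, A (ebs p) = aVal (r ^ 2) ε p.1.1 p.1.2) (j k : ℤ) :
    ContinuousLinearMap.adjoint A (ejk j k) =
      (a1 r ε (j - 1) (k + 1) : ℂ) • ejk (j - 1) (k + 1) + (a2 r (j - 2) k : ℂ) • ejk (j - 2) k
      - (a3 r j (k + 2) : ℂ) • ejk j (k + 2) := by
  by_cases h : IdxP (j + k, j - k)
  · refine vec_ext_ebs fun p => ?_
    obtain ⟨j', k', hj, hk, hjk, -, -, hp⟩ := exists_ejk p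
    have h' := (idxP_iff j' k').2 ⟨hj, hk, hjk⟩
    have e1 := inner_smul_ejk_shift _ 1 (-1) h h' (a1 r ε) rfl
    have e2 := inner_smul_ejk_shift _ 2 0 h h' (a2 r) rfl
    have e3 := inner_smul_ejk_shift _ 0 (-2) h h' (a3 r) rfl
    simp only [← sub_eq_add_neg, sub_neg_eq_add, add_zero, sub_zero] at e1 e2 e3
    rw [hp, ContinuousLinearMap.adjoint_inner_right, apply_a_ejk hr0 hr1 hA]
    simp only [inner_add_left, inner_sub_left, inner_add_right, inner_sub_right, e1, e2, e3]
  · have h1 : a1 r ε (j - 1) (k + 1) = 0 ∨ ejk (j - 1) (k + 1) = 0 := by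
      by_cases h' : IdxP (j - 1 + (k + 1), j - 1 - (k + 1))
      · left
        rw [idxP_iff] at h h'
        rw [a1, sqn_of_nonpos hr0 hr1 (n := k + 1) (by grind)]
        simp
      · exact .inr (ejk_of_not_valid h')
    have h2 : ejk (j - 2) k = 0 := by
      refine ejk_of_not_valid fun h' => ?_
      rw [idxP_iff] at h h'
      grind
    have h3 : a3 r j (k + 2) = 0 ∨ ejk j (k + 2) = 0 := by
      by_cases h' : IdxP (j + (k + 2), j - (k + 2))
      · left
        rw [idxP_iff] at h h'
        rw [a3, sqn_of_nonpos hr0 hr1 (n := k + 2 - 1) (by grind)]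
        simp
      · exact .inr (ejk_of_not_valid h')
    rw [ejk_of_not_valid h, map_zero, h2]
    rcases h1 with h1 | h1 <;> rcases h3 with h3 | h3 <;> simp [h1, h3]

end Operators

section Identities

variable {r : ℝ}

lemma qint_shift (hr0 : 0 < r) (c j : ℤ) :
    qint r (c + j) = ((r ^ c) ^ 2 * (r ^ j) ^ 2 - ((r ^ c) ^ 2 * (r ^ j) ^ 2)⁻¹) /
      ((r ^ 4 - 1) / r ^ 2) := by
  have hr := hr0.ne'
  have hD : r ^ 2 - (r ^ 2)⁻¹ = (r ^ 4 - 1) / r ^ 2 := by field_simp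
  rw [qint, zpow_neg, mul_comm, zpow_mul, zpow_add₀ hr, hD]
  simp [mul_pow]

lemma qint_eq (hr0 : 0 < r) (j : ℤ) :
    qint r j = ((r ^ j) ^ 2 - ((r ^ j) ^ 2)⁻¹) / ((r ^ 4 - 1) / r ^ 2) := by
  simpa using qint_shift hr0 0 j

lemma qint_add_shift (hr0 : 0 < r) (j k c : ℤ) :
    qint r (j + k + c) = ((r ^ c) ^ 2 * (r ^ j) ^ 2 * (r ^ k) ^ 2 -
      ((r ^ c) ^ 2 * (r ^ j) ^ 2 * (r ^ k) ^ 2)⁻¹) / ((r ^ 4 - 1) / r ^ 2) := by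
  rw [add_comm, qint_shift hr0, zpow_add₀ hr0.ne', mul_pow, mul_assoc]

lemma sqn_mul_sqn_pred_sq (hr0 : 0 < r) (hr1 : r < 1) {k : ℤ} (hk : 0 ≤ k) :
    (sqn r k * sqn r (k + -1)) ^ 2 = qint r k * qint r (k + -1) := by
  rcases hk.eq_or_lt with rfl | hk
  · simp [qint_zero, sqn_of_nonpos hr0 hr1 le_rfl]
  · rw [mul_pow, sqn_sq hr0 hr1 hk.le, sqn_sq hr0 hr1 (by omega)]

lemma a3_sq (hr0 : 0 < r) (hr1 : r < 1) {j k : ℤ} (hk : 0 ≤ k) :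
    a3 r j k ^ 2 = (r ^ (2 * j + 1) / qint r (j + k)) ^ 2 * (qint r k * qint r (k + -1)) := by
  rw [a3, mul_pow, sub_eq_add_neg, sqn_mul_sqn_pred_sq hr0 hr1 hk]

lemma a2_sq (hr0 : 0 < r) (hr1 : r < 1) {j k : ℤ} (hj : 0 ≤ j) :
    a2 r (j + -2) k ^ 2 =
      (r ^ (-(2 * k) - 1) / qint r (j + k)) ^ 2 * (qint r j * qint r (j + -1)) := by
  rw [a2, mul_pow, ← sqn_mul_sqn_pred_sq hr0 hr1 hj, show j + -2 + 1 = j + -1 by ring,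
    show j + -2 + 2 = j by ring, show j + -2 + k + 2 = j + k by ring]
  ring

set_option maxHeartbeats 4000000 in
lemma coeff_b_mul_a (hr0 : 0 < r) (hr1 : r < 1) {ε : ℝ} (hε : ε ^ 2 = 1) {j k : ℤ}
    (hj : 0 ≤ j) (hk : 0 ≤ k) (hjk : Odd (j + k)) :
    (-(a2 r j k * b2 r (j + 2) k) = r ^ 4 * -(b2 r j k * a2 r (j + 1) (k + 1))) ∧
    (-(a1 r ε j k * b2 r (j + 1) (k + -1)) + a2 r j k * b1 r ε (j + 2) k =
      r ^ 4 * (b1 r ε j k * a2 r j k - b2 r j k * a1 r ε (j + 1) (k + 1))) ∧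
    (0 < k → a1 r ε j k * b1 r ε (j + 1) (k + -1) - a2 r j k * b3 r (j + 2) k +
        a3 r j k * b2 r j (k + -2) =
      r ^ 4 * (b1 r ε j k * a1 r ε j k + b2 r j k * a3 r (j + 1) (k + 1) -
        b3 r j k * a2 r (j + -1) (k + -1))) ∧
    (-(a1 r ε j k * b3 r (j + 1) (k + -1)) - a3 r j k * b1 r ε j (k + -2) =
      r ^ 4 * (-(b1 r ε j k * a3 r j k) - b3 r j k * a1 r ε (j + -1) (k + -1))) ∧
    (a3 r j k * b3 r j (k + -2) = r ^ 4 * (b3 r j k * a3 r (j + -1) (k + -1))) := by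
  obtain ⟨n, hn⟩ : ∃ n, n = j + k := ⟨_, rfl⟩
  have h1 : ∀ c d, j + c + (k + d) = n + (c + d) := by intros; omega
  have h2 : ∀ c, j + c + k = n + c := by intros; omega
  have h3 : ∀ d, j + (k + d) = n + d := by intros; omega
  have hU := qint_ne_zero hr0 hr1 (n := n) (by grind)
  have hU2 := qint_ne_zero hr0 hr1 (n := n + 2) (by grind)
  have hU4 := qint_ne_zero hr0 hr1 (n := n + 4) (by grind)
  have hV2 := qint_ne_zero hr0 hr1 (n := n + -2) (by grind)
  have eU := qint_add_shift hr0 j k 0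
  have eU2 := qint_add_shift hr0 j k 2
  have eU4 := qint_add_shift hr0 j k 4
  have eV2 := qint_add_shift hr0 j k (-2)
  have hr := hr0.ne'
  have hD : r ^ 4 - 1 ≠ 0 := (sub_neg.2 (pow_lt_one₀ hr0.le hr1 (by norm_num))).ne
  have hX : r ^ j ≠ 0 := zpow_ne_zero j hr
  have hY : r ^ k ≠ 0 := zpow_ne_zero k hr
  simp only [← hn, add_zero, zpow_neg, zpow_ofNat] at eU eU2 eU4 eV2
  refine ⟨?_, ?_, ?_, ?_, ?_⟩
  all_goals
    intros
    simp only [a1, a2, a3, b1, b2, b3, h1, h2, h3, ← hn, sub_eq_add_neg, add_assoc,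
      Int.reduceAdd, Int.reduceNeg, add_zero, mul_add, zpow_add₀ hr, neg_add, zpow_neg, zpow_mul',
      neg_neg, zpow_ofNat]
    generalize qint r n = U at *
    generalize qint r (n + 2) = U2 at *
    generalize qint r (n + 4) = U4 at *
    generalize qint r (n + -2) = V2 at *
    ring_nf
    try simp (disch := omega) only [sqn_sq hr0 hr1, hε]
    try simp only [qint_shift hr0, qint_eq hr0 j, qint_eq hr0 k, zpow_neg, zpow_ofNat]
    all_goals generalize r ^ j = X at *
    all_goals generalize r ^ k = Y at *
    try field_simp
    try simp only [eU, eU2, eU4, eV2]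
    try field_simp
    try ring

set_option maxHeartbeats 4000000 in
lemma coeff_star_a_mul_a (hr0 : 0 < r) (hr1 : r < 1) {ε : ℝ} (hε : ε ^ 2 = 1) {j k : ℤ}
    (hj : 0 ≤ j) (hk : 0 ≤ k) (hjk : Odd (j + k)) :
    (-(a2 r j k * a3 r (j + 2) (k + 2)) + b2 r j k * b2 r (j + 1) (k + 1) = 0) ∧
    (-(a1 r ε j k * a3 r (j + 1) (k + 1)) + a2 r j k * a1 r ε (j + 1) (k + 1) -
      b1 r ε j k * b2 r j k - b2 r j k * b1 r ε (j + 1) (k + 1) = 0) ∧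
    (a1 r ε j k ^ 2 + a2 r j k ^ 2 + a3 r j k ^ 2 + b1 r ε j k ^ 2 +
      b2 r j k * b3 r (j + 1) (k + 1) + b3 r j k * b2 r (j + -1) (k + -1) = 1) ∧
    (0 < k → a1 r ε j k * a2 r (j + -1) (k + -1) - a3 r j k * a1 r ε (j + -1) (k + -1) -
      b1 r ε j k * b3 r j k - b3 r j k * b1 r ε (j + -1) (k + -1) = 0) ∧
    (-(a3 r j k * a2 r (j + -2) (k + -2)) + b3 r j k * b3 r (j + -1) (k + -1) = 0) := by
  obtain ⟨n, hn⟩ : ∃ n, n = j + k := ⟨_, rfl⟩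
  have h1 : ∀ c d, j + c + (k + d) = n + (c + d) := by intros; omega
  have hU := qint_ne_zero hr0 hr1 (n := n) (by grind)
  have hU2 := qint_ne_zero hr0 hr1 (n := n + 2) (by grind)
  have hU4 := qint_ne_zero hr0 hr1 (n := n + 4) (by grind)
  have hV2 := qint_ne_zero hr0 hr1 (n := n + -2) (by grind)
  have eU := qint_add_shift hr0 j k 0
  have eU2 := qint_add_shift hr0 j k 2
  have eU4 := qint_add_shift hr0 j k 4
  have eV2 := qint_add_shift hr0 j k (-2)
  have hr := hr0.ne'
  have hD : r ^ 4 - 1 ≠ 0 := (sub_neg.2 (pow_lt_one₀ hr0.le hr1 (by norm_num))).ne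
  have hX : r ^ j ≠ 0 := zpow_ne_zero j hr
  have hY : r ^ k ≠ 0 := zpow_ne_zero k hr
  simp only [← hn, add_zero, zpow_neg, zpow_ofNat] at eU eU2 eU4 eV2
  refine ⟨?_, ?_, ?_, ?_, ?_⟩
  all_goals
    intros
    try rw [a3_sq hr0 hr1 hk]
    simp only [a1, a2, a3, b1, b2, b3, h1, ← hn, sub_eq_add_neg, add_assoc,
      Int.reduceAdd, Int.reduceNeg, add_zero, mul_add, zpow_add₀ hr, neg_add, zpow_neg, zpow_mul',
      neg_neg, zpow_ofNat]
    generalize qint r n = U at *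
    generalize qint r (n + 2) = U2 at *
    generalize qint r (n + 4) = U4 at *
    generalize qint r (n + -2) = V2 at *
    ring_nf
    try simp (disch := omega) only [sqn_sq hr0 hr1, hε]
    try simp only [qint_shift hr0, qint_eq hr0 j, qint_eq hr0 k, zpow_neg, zpow_ofNat]
    all_goals generalize r ^ j = X at *
    all_goals generalize r ^ k = Y at *
    try field_simp
    try simp only [eU, eU2, eU4, eV2]
    try field_simp
    try ring

set_option maxHeartbeats 4000000 in
lemma coeff_a_mul_star_a (hr0 : 0 < r) (hr1 : r < 1) {ε : ℝ} (hε : ε ^ 2 = 1) {j k : ℤ}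
    (hj : 0 ≤ j) (hk : 0 ≤ k) (hjk : Odd (j + k)) :
    (-(r ^ 4 * (a3 r j (k + 2) * a2 r j (k + 2))) +
      (r ^ 4)⁻¹ * (b2 r j k * b2 r (j + 1) (k + 1)) = 0) ∧
    (r ^ 4 * (a1 r ε (j + -1) (k + 1) * a2 r (j + -1) (k + 1) - a3 r j (k + 2) * a1 r ε j (k + 2)) -
      (r ^ 4)⁻¹ * (b1 r ε j k * b2 r j k + b2 r j k * b1 r ε (j + 1) (k + 1)) = 0) ∧
    (r ^ 4 * (a1 r ε (j + -1) (k + 1) ^ 2 + a2 r (j + -2) k ^ 2 + a3 r j (k + 2) ^ 2) +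
      (r ^ 4)⁻¹ * (b1 r ε j k ^ 2 + b2 r j k * b3 r (j + 1) (k + 1) +
        b3 r j k * b2 r (j + -1) (k + -1)) = r ^ 4) ∧
    (0 < j → r ^ 4 * (a2 r (j + -2) k * a1 r ε (j + -2) k -
        a1 r ε (j + -1) (k + 1) * a3 r (j + -1) (k + 1)) -
      (r ^ 4)⁻¹ * (b1 r ε j k * b3 r j k + b3 r j k * b1 r ε (j + -1) (k + -1)) = 0) ∧
    (-(r ^ 4 * (a2 r (j + -2) k * a3 r (j + -2) k)) +
      (r ^ 4)⁻¹ * (b3 r j k * b3 r (j + -1) (k + -1)) = 0) := by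
  obtain ⟨n, hn⟩ : ∃ n, n = j + k := ⟨_, rfl⟩
  have h1 : ∀ c d, j + c + (k + d) = n + (c + d) := by intros; omega
  have h2 : ∀ c, j + c + k = n + c := by intros; omega
  have h3 : ∀ d, j + (k + d) = n + d := by intros; omega
  have hU := qint_ne_zero hr0 hr1 (n := n) (by grind)
  have hU2 := qint_ne_zero hr0 hr1 (n := n + 2) (by grind)
  have hU4 := qint_ne_zero hr0 hr1 (n := n + 4) (by grind)
  have hV2 := qint_ne_zero hr0 hr1 (n := n + -2) (by grind)
  have eU := qint_add_shift hr0 j k 0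
  have eU2 := qint_add_shift hr0 j k 2
  have eU4 := qint_add_shift hr0 j k 4
  have eV2 := qint_add_shift hr0 j k (-2)
  have hr := hr0.ne'
  have hD : r ^ 4 - 1 ≠ 0 := (sub_neg.2 (pow_lt_one₀ hr0.le hr1 (by norm_num))).ne
  have hX : r ^ j ≠ 0 := zpow_ne_zero j hr
  have hY : r ^ k ≠ 0 := zpow_ne_zero k hr
  simp only [← hn, add_zero, zpow_neg, zpow_ofNat] at eU eU2 eU4 eV2
  refine ⟨?_, ?_, ?_, ?_, ?_⟩
  all_goals
    intros
    try rw [a2_sq hr0 hr1 hj]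
    simp only [a1, a2, a3, b1, b2, b3, h1, h2, h3, ← hn, sub_eq_add_neg, add_assoc,
      Int.reduceAdd, Int.reduceNeg, add_zero, mul_add, zpow_add₀ hr, neg_add, zpow_neg, zpow_mul',
      neg_neg, zpow_ofNat]
    generalize qint r n = U at *
    generalize qint r (n + 2) = U2 at *
    generalize qint r (n + 4) = U4 at *
    generalize qint r (n + -2) = V2 at *
    ring_nf
    try simp (disch := omega) only [sqn_sq hr0 hr1, hε]
    try simp only [qint_shift hr0, qint_eq hr0 j, qint_eq hr0 k, zpow_neg, zpow_ofNat]
    all_goals generalize r ^ j = X at *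
    all_goals generalize r ^ k = Y at *
    try field_simp
    try simp only [eU, eU2, eU4, eV2]
    try field_simp
    try ring

end Identities

section Relations

variable {r ε : ℝ} {A B : Hh →L[ℂ] Hh}

lemma b_mul_a (hr0 : 0 < r) (hr1 : r < 1) (hε : ε ^ 2 = 1)
    (hA : ∀ p : Idx, A (ebs p) = aVal (r ^ 2) ε p.1.1 p.1.2)
    (hB : ∀ p : Idx, B (ebs p) = bVal (r ^ 2) ε p.1.1 p.1.2) :
    B * A = ((r : ℂ) ^ 4) • (A * B) := by
  refine clm_ext_ebs fun p => ?_
  obtain ⟨j, k, hj, hk, hjk, -, -, hp⟩ := exists_ejk p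
  obtain ⟨c1, c2, c3, c4, c5⟩ := coeff_b_mul_a hr0 hr1 hε hj hk hjk
  replace c3 : a1 r ε j k * b1 r ε (j + 1) (k + -1) - a2 r j k * b3 r (j + 2) k +
      a3 r j k * b2 r j (k + -2) =
      r ^ 4 * (b1 r ε j k * a1 r ε j k + b2 r j k * a3 r (j + 1) (k + 1) -
        b3 r j k * a2 r (j + -1) (k + -1)) := by
    rcases hk.eq_or_lt with rfl | hk
    · simp [a1, a3, b2, b3, sqn_of_nonpos hr0 hr1 le_rfl]
    · exact c3 hk
  apply_fun ((↑) : ℝ → ℂ) at c1 c2 c3 c4 c5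
  push_cast at c1 c2 c3 c4 c5
  simp only [hp, mul_apply_eq_comp, smul_apply,
    apply_a_ejk hr0 hr1 hA, apply_b_ejk hr0 hr1 hB, map_add, map_neg, map_smul,
    sub_eq_add_neg, add_assoc, Int.reduceAdd, Int.reduceNeg, add_zero]
  linear_combination (norm := module) c1 • ejk (j + 3) (k + 1) + c2 • ejk (j + 2) k +
    c3 • ejk (j + 1) (k + -1) + c4 • ejk j (k + -2) + c5 • ejk (j + -1) (k + -3)

lemma star_a_mul_a (hr0 : 0 < r) (hr1 : r < 1) (hε : ε ^ 2 = 1)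
    (hA : ∀ p : Idx, A (ebs p) = aVal (r ^ 2) ε p.1.1 p.1.2)
    (hB : ∀ p : Idx, B (ebs p) = bVal (r ^ 2) ε p.1.1 p.1.2) :
    ContinuousLinearMap.adjoint A * A + B * B = 1 := by
  refine clm_ext_ebs fun p => ?_
  obtain ⟨j, k, hj, hk, hjk, -, -, hp⟩ := exists_ejk p
  obtain ⟨c1, c2, c3, c4, c5⟩ := coeff_star_a_mul_a hr0 hr1 hε hj hk hjk
  replace c4 : a1 r ε j k * a2 r (j + -1) (k + -1) - a3 r j k * a1 r ε (j + -1) (k + -1) -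
      b1 r ε j k * b3 r j k - b3 r j k * b1 r ε (j + -1) (k + -1) = 0 := by
    rcases hk.eq_or_lt with rfl | hk
    · simp [a1, a3, b3, sqn_of_nonpos hr0 hr1 le_rfl]
    · exact c4 hk
  apply_fun ((↑) : ℝ → ℂ) at c1 c2 c3 c4 c5
  push_cast at c1 c2 c3 c4 c5
  simp only [hp, mul_apply_eq_comp, add_apply,
    one_apply_eq_self, apply_a_ejk hr0 hr1 hA, apply_b_ejk hr0 hr1 hB,
    adjoint_a_ejk hr0 hr1 hA, map_add, map_neg, map_smul,
    sub_eq_add_neg, add_assoc, Int.reduceAdd, Int.reduceNeg, add_zero]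
  linear_combination (norm := module) c1 • ejk (j + 2) (k + 2) + c2 • ejk (j + 1) (k + 1) +
    c3 • ejk j k + c4 • ejk (j + -1) (k + -1) + c5 • ejk (j + -2) (k + -2)

lemma a_mul_star_a (hr0 : 0 < r) (hr1 : r < 1) (hε : ε ^ 2 = 1)
    (hA : ∀ p : Idx, A (ebs p) = aVal (r ^ 2) ε p.1.1 p.1.2)
    (hB : ∀ p : Idx, B (ebs p) = bVal (r ^ 2) ε p.1.1 p.1.2) :
    ((r : ℂ) ^ 4) • (A * ContinuousLinearMap.adjoint A) + ((r : ℂ) ^ 4)⁻¹ • (B * B)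
      = ((r : ℂ) ^ 4) • (1 : Hh →L[ℂ] Hh) := by
  refine clm_ext_ebs fun p => ?_
  obtain ⟨j, k, hj, hk, hjk, -, -, hp⟩ := exists_ejk p
  obtain ⟨c1, c2, c3, c4, c5⟩ := coeff_a_mul_star_a hr0 hr1 hε hj hk hjk
  replace c4 : r ^ 4 * (a2 r (j + -2) k * a1 r ε (j + -2) k -
      a1 r ε (j + -1) (k + 1) * a3 r (j + -1) (k + 1)) -
      (r ^ 4)⁻¹ * (b1 r ε j k * b3 r j k + b3 r j k * b1 r ε (j + -1) (k + -1)) = 0 := by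
    rcases hj.eq_or_lt with rfl | hj
    · simp [a1, a2, b3, sqn_of_nonpos hr0 hr1 le_rfl]
    · exact c4 hj
  apply_fun ((↑) : ℝ → ℂ) at c1 c2 c3 c4 c5
  push_cast at c1 c2 c3 c4 c5
  simp only [hp, mul_apply_eq_comp, add_apply,
    smul_apply, one_apply_eq_self, apply_a_ejk hr0 hr1 hA,
    apply_b_ejk hr0 hr1 hB, adjoint_a_ejk hr0 hr1 hA, map_add, map_neg, map_smul,
    sub_eq_add_neg, add_assoc, Int.reduceAdd, Int.reduceNeg, add_zero]
  linear_combination (norm := module) c1 • ejk (j + 2) (k + 2) + c2 • ejk (j + 1) (k + 1) +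
    c3 • ejk j k + c4 • ejk (j + -1) (k + -1) + c5 • ejk (j + -2) (k + -2)

end Relations

/-- For each sign `ε ∈ {+, -}`, writing `A = π_ε(a)` and `B = π_ε(b)` for the
bounded extensions, the defining relations of the equatorial Podleś sphere hold:
`BA = q² AB`, `A*B = q² BA*`, `A*A + B² = 1` and `q² AA* + q⁻² B² = q²`. -/
theorem statement1 (q : ℝ) (hq0 : 0 < q) (hq1 : q < 1) (ε : ℝ) (hε : ε = 1 ∨ ε = -1)
    (A B : Hh →L[ℂ] Hh)
    (hA : ∀ p : Idx, A (ebs p) = aVal q ε p.1.1 p.1.2)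
    (hB : ∀ p : Idx, B (ebs p) = bVal q ε p.1.1 p.1.2)
    (hBsa : IsSelfAdjoint B) :
    B * A = ((q : ℂ) ^ 2) • (A * B) ∧
    ContinuousLinearMap.adjoint A * B = ((q : ℂ) ^ 2) • (B * ContinuousLinearMap.adjoint A) ∧
    ContinuousLinearMap.adjoint A * A + B * B = 1 ∧
    ((q : ℂ) ^ 2) • (A * ContinuousLinearMap.adjoint A) + ((q : ℂ) ^ 2)⁻¹ • (B * B)
      = ((q : ℂ) ^ 2) • (1 : Hh →L[ℂ] Hh) := by
  obtain ⟨r, hr0, rfl⟩ : ∃ r : ℝ, 0 < r ∧ r ^ 2 = q :=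
    ⟨√q, Real.sqrt_pos.2 hq0, Real.sq_sqrt hq0.le⟩
  have hr1 : r < 1 := by nlinarith
  have hε2 : ε ^ 2 = 1 := by rcases hε with rfl | rfl <;> norm_num
  have hq : (((r ^ 2 : ℝ) : ℂ)) ^ 2 = (r : ℂ) ^ 4 := by push_cast; ring
  have hBA := b_mul_a hr0 hr1 hε2 hA hB
  rw [hq]
  refine ⟨hBA, ?_, star_a_mul_a hr0 hr1 hε2 hA hB, a_mul_star_a hr0 hr1 hε2 hA hB⟩
  have h := congrArg star hBA
  rw [star_mul, star_smul, star_mul, hBsa.star_eq, ContinuousLinearMap.star_eq_adjoint] at h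
  rw [h]
  simp
end
end

section
/- The antiunitary operator J does not map the algebra A to its commutant: there exist elements x, y ∈ A such that the commutator [x, J y J^{−1}] ≠ 0 as a bounded operator on H. -/
noncomputable section

open scoped ComplexConjugate ENNReal InnerProductSpace

/-- The Hilbert space `H = H_h ⊕ H_h`, realized as `ℓ²` over two copies of the index set;
the Boolean `true` marks the `+` copy and `false` the `-` copy. -/
abbrev HH : Type := lp (fun _ : Idx × Bool => ℂ) 2

/-- The basis vector `|l,m⟩_±` of `H` (`s = true` for `+`, `s = false` for `-`). -/
def bas (p : Idx) (s : Bool) : HH := lp.single 2 (p, s) 1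

/-- The sign `ε` attached to a copy of `H_h` inside `H`. -/
def sgn (s : Bool) : ℝ := if s then 1 else -1

/-- The basis vector `|l,m⟩_±` of `H` (with `L = 2l`, `M = 2m`), defined to be `0` when the
index is out of the allowed range. -/
def ket2 (s : Bool) (L M : ℤ) : HH :=
  if h : IdxP (L, M) then lp.single 2 ((⟨(L, M), h⟩ : Idx), s) 1 else 0

/-- The value of `π(a) = π₊(a) ⊕ π₋(a)` on the basis vector `|l,m⟩_±` of `H`. -/
def aVal2 (q : ℝ) (s : Bool) (L M : ℤ) : HH :=
  ((aC1 q (sgn s) (L/2 : ℝ) (M/2 : ℝ) : ℝ) : ℂ) • ket2 s L (M + 2)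
    + ((aC2 q (L/2 : ℝ) (M/2 : ℝ) : ℝ) : ℂ) • ket2 s (L + 2) (M + 2)
    - ((aC3 q (L/2 : ℝ) (M/2 : ℝ) : ℝ) : ℂ) • ket2 s (L - 2) (M + 2)

/-- The value of `π(b) = π₊(b) ⊕ π₋(b)` on the basis vector `|l,m⟩_±` of `H`. -/
def bVal2 (q : ℝ) (s : Bool) (L M : ℤ) : HH :=
  ((bC1 q (sgn s) (L/2 : ℝ) (M/2 : ℝ) : ℝ) : ℂ) • ket2 s L M
    - ((bC2 q (L/2 : ℝ) (M/2 : ℝ) : ℝ) : ℂ) • ket2 s (L + 2) M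
    - ((bC3 q (L/2 : ℝ) (M/2 : ℝ) : ℝ) : ℂ) • ket2 s (L - 2) M

/-- The index map `(l, m) ↦ (l, -m)`. -/
def pFlip (p : Idx) : Idx :=
  ⟨(p.1.1, -p.1.2), p.2.1, p.2.2.1, p.2.2.2.1.neg, by simpa using p.2.2.2.2⟩

lemma qn_natCast (q : ℝ) (n : ℕ) : qn q n = (q ^ n - (q ^ n)⁻¹) / (q - q⁻¹) := by
  unfold qn
  rw [← Real.rpow_natCast q n, Real.rpow_neg_natCast, zpow_neg, zpow_natCast, Real.rpow_natCast]

lemma qn_zero (q : ℝ) : qn q 0 = 0 := by simp [qn]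

section qNumbers

variable {q : ℝ}

lemma sub_inv_ne_zero_of_lt_one (hq0 : 0 < q) (hq1 : q < 1) : q - q⁻¹ ≠ 0 := by
  have := (one_lt_inv₀ hq0).2 hq1
  linarith

lemma qn_one (hq0 : 0 < q) (hq1 : q < 1) : qn q 1 = 1 := by
  have h := qn_natCast q 1
  have := sub_inv_ne_zero_of_lt_one hq0 hq1
  push_cast at h
  rw [h, div_eq_iff this]
  ring

lemma qn_two (hq0 : 0 < q) (hq1 : q < 1) : qn q 2 = (1 + q ^ 2) / q := by
  have h := qn_natCast q 2
  have := sub_inv_ne_zero_of_lt_one hq0 hq1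
  push_cast at h
  rw [h, div_eq_iff this]
  field_simp
  ring

lemma qn_three (hq0 : 0 < q) (hq1 : q < 1) : qn q 3 = (1 + q ^ 2 + q ^ 4) / q ^ 2 := by
  have h := qn_natCast q 3
  have := sub_inv_ne_zero_of_lt_one hq0 hq1
  push_cast at h
  rw [h, div_eq_iff this]
  field_simp
  ring

lemma qn_five (hq0 : 0 < q) (hq1 : q < 1) :
    qn q 5 = (1 + q ^ 2 + q ^ 4 + q ^ 6 + q ^ 8) / q ^ 4 := by
  have h := qn_natCast q 5
  have := sub_inv_ne_zero_of_lt_one hq0 hq1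
  push_cast at h
  rw [h, div_eq_iff this]
  field_simp
  ring

/-- The matrix element `|1/2, 1/2⟩₊ → |3/2, 1/2⟩₊` of `[π(b), J π(b) J⁻¹]` does not vanish. -/
lemma bC_commutator_ne (hq0 : 0 < q) (hq1 : q < 1) :
    bC1 q (-1) (1/2) (-1/2) * bC2 q (1/2) (1/2) + bC1 q 1 (3/2) (1/2) * bC2 q (1/2) (-1/2) ≠
      bC1 q 1 (1/2) (1/2) * bC2 q (1/2) (-1/2) + bC1 q (-1) (3/2) (-1/2) * bC2 q (1/2) (1/2) := by
  have hr : q ^ ((1:ℝ)/2 + 1) = q * q ^ ((1:ℝ)/2) := by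
    rw [Real.rpow_add hq0, Real.rpow_one, mul_comm]
  have hr' : q ^ ((-1:ℝ)/2 + 1) = q ^ ((1:ℝ)/2) := by norm_num
  have hpos : 0 < q ^ ((1:ℝ)/2) := Real.rpow_pos_of_pos hq0 _
  unfold bC1 bC2
  rw [hr, hr']
  norm_num [qn_zero, qn_one hq0 hq1, qn_two hq0 hq1, qn_three hq0 hq1, qn_five hq0 hq1] at hpos ⊢
  set u := q ^ ((1:ℝ)/2)
  have ht : 0 < √((1 + q ^ 2) / q) := by positivity
  set t := √((1 + q ^ 2) / q)
  have h3 : 0 < 1 - q ^ 3 := sub_pos.2 (pow_lt_one₀ hq0.le hq1 (by norm_num))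
  have h5 : 0 < 1 - q ^ 5 := sub_pos.2 (pow_lt_one₀ hq0.le hq1 (by norm_num))
  have hdiff : 0 < u * t * q ^ 4 * (1 - q ^ 3) ^ 2 * (1 - q ^ 5) /
      ((1 + q ^ 2 + q ^ 4) ^ 2 * (1 + q ^ 2 + q ^ 4 + q ^ 6 + q ^ 8)) := by
    positivity
  refine fun h => hdiff.ne ?_
  rw [← sub_eq_zero] at h
  rw [← neg_eq_zero.2 h]
  field_simp
  ring

end qNumbers

lemma ket2_of_idxP (s : Bool) {L M : ℤ} (h : IdxP (L, M)) : ket2 s L M = bas ⟨(L, M), h⟩ s := by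
  simp [ket2, bas, h]

lemma ket2_of_nonpos (s : Bool) {L M : ℤ} (h : L ≤ 0) : ket2 s L M = 0 := by
  have : ¬ IdxP (L, M) := fun h' => absurd h'.1 (not_lt.2 h)
  simp [ket2, this]

/-- The coordinates of a basis vector. -/
lemma ket2_apply (s s' : Bool) {L M : ℤ} (h : IdxP (L, M)) (p : Idx) :
    (ket2 s L M : Idx × Bool → ℂ) (p, s') = if p.1 = (L, M) ∧ s' = s then 1 else 0 := by
  rw [ket2_of_idxP s h, bas, lp.single_apply]
  by_cases hp : p.1 = (L, M) ∧ s' = s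
  · obtain ⟨h1, rfl⟩ := hp
    obtain rfl : p = ⟨(L, M), h⟩ := Subtype.ext h1
    simp
  · rw [if_neg hp, Pi.single_eq_of_ne]
    intro h'
    rw [Prod.mk.injEq] at h'
    exact hp ⟨congrArg Subtype.val h'.1, h'.2⟩

/-- `J` does not map the algebra `A` into its commutant: there are `x, y ∈ A`
with `[x, JyJ⁻¹] ≠ 0` (recall `J⁻¹ = -J`). -/
theorem statement6 (q : ℝ) (hq0 : 0 < q) (hq1 : q < 1)
    (πa πb : HH →L[ℂ] HH)
    (hπa : ∀ (p : Idx) (s : Bool), πa (bas p s) = aVal2 q s p.1.1 p.1.2)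
    (hπb : ∀ (p : Idx) (s : Bool), πb (bas p s) = bVal2 q s p.1.1 p.1.2)
    (J : HH →SL[starRingEnd ℂ] HH)
    (hJ : ∀ (p : Idx) (s : Bool), J (bas p s) = (Complex.I ^ p.1.2) • bas (pFlip p) (!s))
    :
    ∃ x ∈ StarAlgebra.adjoin ℂ ({πa, πb} : Set (HH →L[ℂ] HH)),
      ∃ y ∈ StarAlgebra.adjoin ℂ ({πa, πb} : Set (HH →L[ℂ] HH)),
        ∃ v : HH, x (J (y (-(J v)))) ≠ J (y (-(J (x v)))) := by
  have h11 : IdxP (1, 1) := by refine ⟨?_, ?_, ?_, ?_⟩ <;> decide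
  have h1n : IdxP (1, -1) := by refine ⟨?_, ?_, ?_, ?_⟩ <;> decide
  have h31 : IdxP (3, 1) := by refine ⟨?_, ?_, ?_, ?_⟩ <;> decide
  have h3n : IdxP (3, -1) := by refine ⟨?_, ?_, ?_, ?_⟩ <;> decide
  have h51 : IdxP (5, 1) := by refine ⟨?_, ?_, ?_, ?_⟩ <;> decide
  have h5n : IdxP (5, -1) := by refine ⟨?_, ?_, ?_, ?_⟩ <;> decide
  have hb (s : Bool) {L M : ℤ} (h : IdxP (L, M)) : πb (ket2 s L M) = bVal2 q s L M := by
    rw [ket2_of_idxP s h, hπb]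
  have hb1 (s : Bool) (M : ℤ) (h : IdxP (1, M)) : πb (ket2 s 1 M) =
      (bC1 q (sgn s) (1/2) (M/2) : ℂ) • ket2 s 1 M - (bC2 q (1/2) (M/2) : ℂ) • ket2 s 3 M := by
    rw [hb s h, bVal2, ket2_of_nonpos s (show (1 : ℤ) - 2 ≤ 0 by norm_num)]
    norm_num
  have hb3 (s : Bool) (M : ℤ) (h : IdxP (3, M)) : πb (ket2 s 3 M) =
      (bC1 q (sgn s) (3/2) (M/2) : ℂ) • ket2 s 3 M - (bC2 q (3/2) (M/2) : ℂ) • ket2 s 5 M -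
        (bC3 q (3/2) (M/2) : ℂ) • ket2 s 1 M := by
    rw [hb s h, bVal2]
    norm_num
  have hJk (s : Bool) {L M : ℤ} (h : IdxP (L, M)) :
      J (ket2 s L M) = Complex.I ^ M • ket2 (!s) L (-M) := by
    rw [ket2_of_idxP s h, hJ, ket2_of_idxP (!s) (M := -M) (pFlip ⟨(L, M), h⟩).2]
    rfl
  have hJ1 (s : Bool) {L : ℤ} (h : IdxP (L, 1)) :
      J (ket2 s L 1) = Complex.I • ket2 (!s) L (-1) := by
    rw [hJk s h, zpow_one]
  have hJn (s : Bool) {L : ℤ} (h : IdxP (L, -1)) :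
      J (ket2 s L (-1)) = -Complex.I • ket2 (!s) L 1 := by
    rw [hJk s h, zpow_neg_one, Complex.inv_I, neg_neg]
  have hmem : πb ∈ StarAlgebra.adjoin ℂ ({πa, πb} : Set (HH →L[ℂ] HH)) :=
    StarAlgebra.subset_adjoin ℂ _ (by simp)
  refine ⟨πb, hmem, πb, hmem, ket2 true 1 1, fun heq => bC_commutator_ne hq0 hq1 ?_⟩
  obtain ⟨φ, hφ⟩ : ∃ φ : HH →L[ℂ] ℂ, ∀ v, φ v = (v : Idx × Bool → ℂ) (⟨(3, 1), h31⟩, true) :=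
    ⟨lp.evalCLM ℂ _ 2 _, fun _ => rfl⟩
  have hφ1 : φ (ket2 true 1 1) = 0 := by simp [hφ, ket2_apply _ _ h11]
  have hφ3 : φ (ket2 true 3 1) = 1 := by simp [hφ, ket2_apply _ _ h31]
  have hφ5 : φ (ket2 true 5 1) = 0 := by simp [hφ, ket2_apply _ _ h51]
  have e := congrArg φ heq
  simp only [hb1 _ 1 h11, hb1 _ (-1) h1n, hb3 _ 1 h31, hb3 _ (-1) h3n, hJ1 _ h11, hJ1 _ h31,
    hJn _ h1n, hJn _ h3n, hJn _ h5n, map_sub, map_neg, map_smul, map_smulₛₗ, Bool.not_true,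
    Bool.not_false, hφ1, hφ3, hφ5] at e
  simp only [sgn, Complex.conj_ofReal, Complex.conj_I, smul_eq_mul, if_true, Bool.false_eq_true,
    if_false, Int.cast_neg, Int.cast_one] at e
  apply Complex.ofReal_injective
  push_cast
  linear_combination (norm := (ring_nf; simp only [Complex.I_sq]; ring)) -e
end
end

section
/- The antiunitary operator J maps the algebra A to its commutant modulo compact operators: for all elements x, y ∈ A, the commutator [x, J y J^{−1}] is a compact operator on H. -/
noncomputable section

open scoped ComplexConjugate ENNReal InnerProductSpace

/-- An operator on `ℓ²` whose values on the standard basis are absolutely summable is compact. -/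
lemma isCompactOperator_of_summable_norm_single {ι : Type*} [DecidableEq ι]
    (T : lp (fun _ : ι => ℂ) 2 →L[ℂ] lp (fun _ : ι => ℂ) 2)
    (hT : Summable fun i => ‖T (lp.single 2 i 1)‖) : IsCompactOperator T := by
  set R : ι → (lp (fun _ : ι => ℂ) 2 →L[ℂ] lp (fun _ : ι => ℂ) 2) := fun i =>
    (innerSL ℂ (lp.single (E := fun _ : ι => ℂ) 2 i 1)).smulRight (T (lp.single 2 i 1)) with hR
  have hRv : ∀ i v, R i v = T (lp.single 2 i (v i)) := by
    intro i v
    have : lp.single (E := fun _ : ι => ℂ) 2 i (v i) = v i • lp.single 2 i 1 := by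
      rw [← lp.single_smul]; simp
    rw [this, map_smul]
    simp [hR, lp.inner_single_left]
  have hsum : Summable R := by
    refine Summable.of_norm_bounded hT fun i => ?_
    rw [hR, ContinuousLinearMap.norm_smulRight_apply, innerSL_apply_norm, lp.norm_single (by simp)]
    simp
  have hTR : ∑' i, R i = T := by
    ext1 v
    have h1 : HasSum (fun i => R i v) ((∑' i, R i) v) :=
      hsum.hasSum.mapL (ContinuousLinearMap.apply ℂ _ v)
    have h2 : HasSum (fun i => T (lp.single 2 i (v i))) (T v) :=
      (lp.hasSum_single (by simp) v).mapL T
    simp only [hRv] at h1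
    exact h1.unique h2
  have ht : Filter.Tendsto (fun s : Finset ι => ∑ i ∈ s, R i) Filter.atTop (nhds T) :=
    hTR ▸ hsum.hasSum
  refine isCompactOperator_of_tendsto ht (Filter.Eventually.of_forall fun s => ?_)
  classical
  induction s using Finset.induction_on with
  | empty => simpa using isCompactOperator_zero
  | insert i s hi ih =>
    rw [Finset.sum_insert hi]
    refine IsCompactOperator.add ?_ ih
    have h := (isCompactOperator_id (E := ℂ)).comp_clm
      (innerSL ℂ (lp.single (E := fun _ : ι => ℂ) 2 i 1))
    exact h.clm_comp (ContinuousLinearMap.toSpanSingleton ℂ (T (lp.single 2 i 1)))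

lemma summable_pow_idx {q : ℝ} (hq0 : 0 < q) (hq1 : q < 1) :
    Summable fun p : Idx × Bool => q ^ p.1.1.1 := by
  let e : Idx × Bool → (ℕ × ℕ) × Bool := fun p =>
    ((((p.1.1.1 + p.1.1.2) / 2).toNat, ((p.1.1.1 - p.1.1.2) / 2).toNat), p.2)
  have hval : ∀ p : Idx × Bool, ((e p).1.1 : ℤ) * 2 = p.1.1.1 + p.1.1.2 ∧
      ((e p).1.2 : ℤ) * 2 = p.1.1.1 - p.1.1.2 := by
    rintro ⟨⟨⟨L, M⟩, h⟩, s⟩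
    obtain ⟨h1, ⟨r, h2⟩, ⟨t, h3⟩, h4⟩ := h
    have h5 := abs_le.1 h4
    simp only [e] at *
    omega
  have he : Function.Injective e := by
    intro p p' h
    have h1 := hval p
    have h2 := hval p'
    rw [h] at h1
    refine Prod.ext (Subtype.ext (Prod.ext ?_ ?_)) (congrArg (fun x => x.2) h)
    · omega
    · omega
  have hs : Summable fun x : (ℕ × ℕ) × Bool => q ^ x.1.1 * q ^ x.1.2 * 1 := by
    have hg := summable_geometric_of_lt_one hq0.le hq1
    have h2 : Summable fun x : ℕ × ℕ => q ^ x.1 * q ^ x.2 :=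
      hg.mul_of_nonneg hg (fun _ => by positivity) (fun _ => by positivity)
    exact h2.mul_of_nonneg (g := fun _ : Bool => (1 : ℝ)) (Summable.of_finite)
      (fun _ => by positivity) (fun _ => by positivity)
  refine (hs.comp_injective he).congr fun p => ?_
  have h1 := hval p
  have : p.1.1.1 = ((e p).1.1 : ℤ) + ((e p).1.2 : ℤ) := by omega
  rw [this, zpow_add₀ hq0.ne']
  simp

/-- The basis vector `|l,m⟩_±` in the coordinates `n = l + m`, `k = l - m`, and zero when these
are out of range. -/
def nkKet (s : Bool) (n k : ℤ) : HH := ket2 s (n + k) (n - k)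

/-- The allowed range of the coordinates `n = l + m`, `k = l - m`. -/
def NKValid (n k : ℤ) : Prop := 0 ≤ n ∧ 0 ≤ k ∧ Odd (n + k)

lemma idxP_iff_nkValid (n k : ℤ) : IdxP (n + k, n - k) ↔ NKValid n k := by
  unfold IdxP NKValid
  simp only [abs_le, Int.odd_iff]
  omega

lemma nkKet_of_valid {n k : ℤ} (h : NKValid n k) (s : Bool) :
    nkKet s n k = bas ⟨(n + k, n - k), (idxP_iff_nkValid n k).2 h⟩ s :=
  dif_pos ((idxP_iff_nkValid n k).2 h)

lemma nkKet_of_not_valid {n k : ℤ} (h : ¬ NKValid n k) (s : Bool) : nkKet s n k = 0 :=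
  dif_neg (mt (idxP_iff_nkValid n k).1 h)

lemma exists_bas_eq_nkKet (p : Idx) :
    ∃ n k, NKValid n k ∧ n + k = p.1.1 ∧ ∀ s, bas p s = nkKet s n k := by
  obtain ⟨⟨L, M⟩, h⟩ := p
  obtain ⟨n, k, rfl, rfl⟩ : ∃ n k : ℤ, L = n + k ∧ M = n - k := by
    obtain ⟨h1, ⟨r, h2⟩, ⟨t, h3⟩, h4⟩ := h
    simp only at *
    exact ⟨r + t + 1, r - t, by omega, by omega⟩
  exact ⟨n, k, (idxP_iff_nkValid n k).1 h, rfl,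
    fun s => (nkKet_of_valid ((idxP_iff_nkValid n k).1 h) s).symm⟩

lemma norm_nkKet_le_one (s : Bool) (n k : ℤ) : ‖nkKet s n k‖ ≤ 1 := by
  by_cases h : NKValid n k
  · rw [nkKet_of_valid h, bas, lp.norm_single (by simp)]
    simp
  · simp [nkKet_of_not_valid h]

lemma ext_nkKet {T S : HH →L[ℂ] HH} (h : ∀ s n k, T (nkKet s n k) = S (nkKet s n k)) : T = S := by
  ext1 v
  have h1 := (lp.hasSum_single (by simp) v).mapL T
  have h2 := (lp.hasSum_single (by simp) v).mapL S
  refine h1.unique (h2.congr_fun ?_)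
  intro i
  obtain ⟨n, k, -, -, hb⟩ := exists_bas_eq_nkKet i.1
  have : lp.single (E := fun _ : Idx × Bool => ℂ) 2 i (v i) = v i • nkKet i.2 n k := by
    rw [← hb, bas, ← lp.single_smul]; simp
  rw [this, map_smul, map_smul, h]

lemma isCompactOperator_of_norm_nkKet_le {q : ℝ} (hq0 : 0 < q) (hq1 : q < 1) (T : HH →L[ℂ] HH)
    (C : ℝ) (hT : ∀ s n k, NKValid n k → ‖T (nkKet s n k)‖ ≤ C * q ^ (n + k)) :
    IsCompactOperator T := by
  refine isCompactOperator_of_summable_norm_single T ?_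
  refine Summable.of_nonneg_of_le (fun _ => norm_nonneg _) (fun i => ?_)
    ((summable_pow_idx hq0 hq1).mul_left C)
  obtain ⟨n, k, hv, hL, hb⟩ := exists_bas_eq_nkKet i.1
  have := hT i.2 n k hv
  rwa [← hb, hL] at this

lemma inner_nkKet (s s' : Bool) (n k n' k' : ℤ) :
    ⟪nkKet s n k, nkKet s' n' k'⟫_ℂ =
      open Classical in if NKValid n k ∧ s = s' ∧ n = n' ∧ k = k' then 1 else 0 := by
  by_cases h : NKValid n k
  · by_cases h' : NKValid n' k'
    · rw [nkKet_of_valid h, nkKet_of_valid h', bas, bas, lp.inner_single_left, lp.single_apply]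
      by_cases e : s = s' ∧ n = n' ∧ k = k'
      · obtain ⟨rfl, rfl, rfl⟩ := e
        simp [h]
      · rw [if_neg (fun hh => e hh.2), Pi.single_apply, if_neg]
        · simp
        · simp only [Prod.mk.injEq, Subtype.mk.injEq]
          rintro ⟨⟨h1, h2⟩, h3⟩
          exact e ⟨h3, by omega, by omega⟩
    · rw [nkKet_of_not_valid h', inner_zero_right, if_neg]
      rintro ⟨-, -, rfl, rfl⟩
      exact h' h
  · simp [nkKet_of_not_valid h, h]

lemma ext_inner_nkKet {v w : HH}
    (h : ∀ s n k, ⟪nkKet s n k, v⟫_ℂ = ⟪nkKet s n k, w⟫_ℂ) : v = w := by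
  ext i
  obtain ⟨n, k, -, -, hb⟩ := exists_bas_eq_nkKet i.1
  have := h i.2 n k
  rw [← hb, bas, lp.inner_single_left, lp.inner_single_left] at this
  simpa using this

/-- The coefficient `f` of a weighted shift by `d` (in the coordinates `n = l + m`, `k = l - m`)
vanishes outside the allowed range and, up to an error of order `q ^ (n + k)`, equals
`c + g n` where `g n` is of order `q ^ n`; the constant `c` is nonzero only if the shift
leaves `k` unchanged. -/
def ShiftCoeff (q : ℝ) (d : ℤ × ℤ) (f : Bool → ℤ → ℤ → ℝ) : Prop :=
  ∃ (c : ℝ) (g : ℤ → ℝ) (C : ℝ), (c ≠ 0 → d.2 = 0) ∧ (∀ n, |g n| ≤ C * q ^ n) ∧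
    (∀ s n k, NKValid n k ∨ NKValid (n + d.1) (k + d.2) →
      |f s n k - (c + g n)| ≤ C * q ^ (n + k)) ∧
    ∀ s n k, ¬ (NKValid n k ∧ NKValid (n + d.1) (k + d.2)) → f s n k = 0

lemma ShiftCoeff.star {q : ℝ} (hq0 : 0 < q) {d : ℤ × ℤ} {f : Bool → ℤ → ℤ → ℝ}
    (hf : ShiftCoeff q d f) : ShiftCoeff q (-d) (fun s n k => f s (n - d.1) (k - d.2)) := by
  obtain ⟨c, g, C, hc, hg, hfg, h0⟩ := hf
  have hC : 0 ≤ C := by simpa using (abs_nonneg _).trans (hg 0)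
  refine ⟨c, fun n => g (n - d.1), C * (q ^ (-d.1) + q ^ (-d.1 - d.2)), ?_, ?_, ?_, ?_⟩
  · simpa using hc
  · intro n
    refine (hg _).trans ?_
    rw [show n - d.1 = -d.1 + n by ring, zpow_add₀ hq0.ne', ← mul_assoc]
    have : 0 < q ^ (-d.1 - d.2) := by positivity
    gcongr
    linarith
  · intro s n k h
    refine (hfg s _ _ ?_).trans ?_
    · simpa [or_comm, sub_eq_add_neg] using h
    · rw [show n - d.1 + (k - d.2) = (-d.1 - d.2) + (n + k) by ring, zpow_add₀ hq0.ne',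
        ← mul_assoc]
      have : 0 < q ^ (-d.1) := by positivity
      gcongr
      linarith
  · intro s n k h
    refine h0 s _ _ ?_
    simpa [and_comm, sub_eq_add_neg] using h

lemma abs_mul_sub_mul_le_of_approx {B x y c c' G₀ G₁ G₀' G₁' F₀ F₁ H₀ H₁ : ℝ}
    (hB : 0 ≤ B) (hx : 0 ≤ x) (hy : 0 ≤ y) (hx1 : x ≤ 1) (hy1 : y ≤ 1)
    (hc : |c| ≤ B) (hc' : |c'| ≤ B)
    (hG₀ : |G₀| ≤ B * x) (hG₁ : |G₁| ≤ B * x) (hG₀' : |G₀'| ≤ B * y) (hG₁' : |G₁'| ≤ B * y)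
    (hcG : c' * (G₁ - G₀) = 0) (hcG' : c * (G₀' - G₁') = 0)
    (hF₀ : |F₀ - (c + G₀)| ≤ B * (x * y)) (hF₁ : |F₁ - (c + G₁)| ≤ B * (x * y))
    (hH₀ : |H₀ - (c' + G₀')| ≤ B * (x * y)) (hH₁ : |H₁ - (c' + G₁')| ≤ B * (x * y)) :
    |F₁ * H₀ - H₁ * F₀| ≤ 12 * B ^ 2 * (x * y) := by
  have hxy : 0 ≤ x * y := by positivity
  have hxy1 : x * y ≤ 1 := mul_le_one₀ hx1 hy hy1
  have key : F₁ * H₀ - H₁ * F₀ = G₁ * G₀' - G₁' * G₀ + (F₁ - (c + G₁)) * H₀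
      + (c + G₁) * (H₀ - (c' + G₀')) - (H₁ - (c' + G₁')) * F₀
      - (c' + G₁') * (F₀ - (c + G₀)) := by
    linear_combination hcG + hcG'
  have hBx : B * x ≤ B := mul_le_of_le_one_right hB hx1
  have hBy : B * y ≤ B := mul_le_of_le_one_right hB hy1
  have hBxy : B * (x * y) ≤ B := mul_le_of_le_one_right hB hxy1
  have a1 : |c + G₁| ≤ 2 * B := (abs_add_le _ _).trans (by linarith)
  have a2 : |c' + G₁'| ≤ 2 * B := (abs_add_le _ _).trans (by linarith)
  have a3 : |H₀| ≤ 3 * B := by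
    have h1 : |c' + G₀'| ≤ 2 * B := (abs_add_le _ _).trans (by linarith)
    have h2 := abs_add_le (H₀ - (c' + G₀')) (c' + G₀')
    rw [sub_add_cancel] at h2
    linarith
  have a4 : |F₀| ≤ 3 * B := by
    have h1 : |c + G₀| ≤ 2 * B := (abs_add_le _ _).trans (by linarith)
    have h2 := abs_add_le (F₀ - (c + G₀)) (c + G₀)
    rw [sub_add_cancel] at h2
    linarith
  have t1 : |G₁ * G₀'| ≤ (B * x) * (B * y) := by rw [abs_mul]; gcongr
  have t2 : |G₁' * G₀| ≤ (B * y) * (B * x) := by rw [abs_mul]; gcongr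
  have t3 : |(F₁ - (c + G₁)) * H₀| ≤ (B * (x * y)) * (3 * B) := by rw [abs_mul]; gcongr
  have t4 : |(c + G₁) * (H₀ - (c' + G₀'))| ≤ (2 * B) * (B * (x * y)) := by
    rw [abs_mul]; gcongr
  have t5 : |(H₁ - (c' + G₁')) * F₀| ≤ (B * (x * y)) * (3 * B) := by rw [abs_mul]; gcongr
  have t6 : |(c' + G₁') * (F₀ - (c + G₀))| ≤ (2 * B) * (B * (x * y)) := by
    rw [abs_mul]; gcongr
  rw [key]
  simp only [abs_le] at t1 t2 t3 t4 t5 t6 ⊢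
  constructor <;> nlinarith

/-- The coefficients of the commutator of a shift and a flipped shift are of order
`q ^ (n + k)`. -/
lemma ShiftCoeff.commutator_bound {q : ℝ} (hq0 : 0 < q) (hq1 : q < 1) {d e : ℤ × ℤ}
    {f h : Bool → ℤ → ℤ → ℝ} (hf : ShiftCoeff q d f) (hh : ShiftCoeff q e h) :
    ∃ C, ∀ s s' n k, NKValid n k →
      |f s (n + e.2) (k + e.1) * h s' k n - h s' (k + d.2) (n + d.1) * f s n k|
        ≤ C * q ^ (n + k) := by
  obtain ⟨c, g, C, hc, hg, hfg, hf0⟩ := hf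
  obtain ⟨c', g', C', hc', hg', hhg, hh0⟩ := hh
  have hC : 0 ≤ C := by simpa using (abs_nonneg _).trans (hg 0)
  have hC' : 0 ≤ C' := by simpa using (abs_nonneg _).trans (hg' 0)
  set Q := 1 + q ^ e.2 + q ^ d.2 + q ^ (e.1 + e.2) + q ^ (d.1 + d.2) with hQ
  have p1 : 0 < q ^ e.2 := by positivity
  have p2 : 0 < q ^ d.2 := by positivity
  have p3 : 0 < q ^ (e.1 + e.2) := by positivity
  have p4 : 0 < q ^ (d.1 + d.2) := by positivity
  have hQ1 : 1 ≤ Q := by linarith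
  set B := |c| + |c'| + (C + C') * Q with hB
  have hB0 : 0 ≤ B := by positivity
  have hCB : C * Q ≤ B := by
    have : 0 ≤ C' * Q := by positivity
    linarith [abs_nonneg c, abs_nonneg c']
  have hCB' : C' * Q ≤ B := by
    have : 0 ≤ C * Q := by positivity
    linarith [abs_nonneg c, abs_nonneg c']
  have up : ∀ {D r z X : ℝ}, 0 ≤ D → D * Q ≤ B → r ≤ Q → 0 ≤ z → X ≤ D * (r * z) → X ≤ B * z := by
    intro D r z X hD hDB hr hz hX
    refine hX.trans ?_
    rw [← mul_assoc]
    exact mul_le_mul_of_nonneg_right ((mul_le_mul_of_nonneg_left hr hD).trans hDB) hz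
  refine ⟨12 * B ^ 2, fun s s' n k hv => ?_⟩
  have hv' : NKValid k n := ⟨hv.2.1, hv.1, add_comm n k ▸ hv.2.2⟩
  have hx : 0 < q ^ n := by positivity
  have hy : 0 < q ^ k := by positivity
  have hxy : 0 ≤ q ^ n * q ^ k := by positivity
  set F₁ := open Classical in if NKValid (n + e.2) (k + e.1) then f s (n + e.2) (k + e.1)
    else c + g (n + e.2) with hF₁
  set H₁ := open Classical in if NKValid (n + d.1) (k + d.2) then h s' (k + d.2) (n + d.1)
    else c' + g' (k + d.2) with hH₁
  have e1 : f s (n + e.2) (k + e.1) * h s' k n = F₁ * h s' k n := by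
    by_cases hp : NKValid (n + e.2) (k + e.1)
    · rw [hF₁, if_pos hp]
    · rw [hh0 s' k n, mul_zero, mul_zero]
      rintro ⟨-, h1, h2, h3⟩
      exact hp ⟨h2, h1, by rwa [add_comm]⟩
  have e2 : h s' (k + d.2) (n + d.1) * f s n k = H₁ * f s n k := by
    by_cases hp : NKValid (n + d.1) (k + d.2)
    · rw [hH₁, if_pos hp]
    · rw [hf0 s n k fun hh => hp hh.2, mul_zero, mul_zero]
  rw [e1, e2, zpow_add₀ hq0.ne']
  refine abs_mul_sub_mul_le_of_approx (c := c) (c' := c') (G₀ := g n) (G₁ := g (n + e.2))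
    (G₀' := g' k) (G₁' := g' (k + d.2)) hB0 hx.le hy.le
    (zpow_le_one₀ hq0 hq1.le hv.1) (zpow_le_one₀ hq0 hq1.le hv.2.1)
    ?_ ?_ ?_ ?_ ?_ ?_ ?_ ?_ ?_ ?_ ?_ ?_
  · have : 0 ≤ (C + C') * Q := by positivity
    linarith [abs_nonneg c']
  · have : 0 ≤ (C + C') * Q := by positivity
    linarith [abs_nonneg c]
  · exact up hC hCB hQ1 hx.le (by simpa using hg n)
  · refine up hC hCB (r := q ^ e.2) (by linarith) hx.le ?_
    rw [← zpow_add₀ hq0.ne', add_comm]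
    exact hg _
  · exact up hC' hCB' hQ1 hy.le (by simpa using hg' k)
  · refine up hC' hCB' (r := q ^ d.2) (by linarith) hy.le ?_
    rw [← zpow_add₀ hq0.ne', add_comm]
    exact hg' _
  · by_cases h0 : c' = 0
    · simp [h0]
    · simp [hc' h0]
  · by_cases h0 : c = 0
    · simp [h0]
    · simp [hc h0]
  · refine up hC hCB hQ1 hxy ?_
    rw [one_mul, ← zpow_add₀ hq0.ne']
    exact hfg s n k (Or.inl hv)
  · refine up hC hCB (r := q ^ (e.1 + e.2)) (by linarith) hxy ?_
    rw [← zpow_add₀ hq0.ne', ← zpow_add₀ hq0.ne',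
      show e.1 + e.2 + (n + k) = n + e.2 + (k + e.1) by ring, hF₁]
    split_ifs with hp
    · exact hfg s _ _ (Or.inl hp)
    · rw [sub_self, abs_zero]
      positivity
  · refine up hC' hCB' hQ1 hxy ?_
    rw [one_mul, ← zpow_add₀ hq0.ne', add_comm n k]
    exact hhg s' k n (Or.inl hv')
  · refine up hC' hCB' (r := q ^ (d.1 + d.2)) (by linarith) hxy ?_
    rw [← zpow_add₀ hq0.ne', ← zpow_add₀ hq0.ne',
      show d.1 + d.2 + (n + k) = k + d.2 + (n + d.1) by ring, hH₁]
    split_ifs with hp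
    · exact hhg s' _ _ (Or.inl ⟨hp.2.1, hp.1, by rw [add_comm]; exact hp.2.2⟩)
    · rw [sub_self, abs_zero]
      positivity

/-- An operator on `HH` acting on the basis as a sum of three shifts with coefficients
satisfying `ShiftCoeff`. -/
def ShiftOp (q : ℝ) (x : HH →L[ℂ] HH) : Prop :=
  ∃ (d : Fin 3 → ℤ × ℤ) (f : Fin 3 → Bool → ℤ → ℤ → ℝ), (∀ i, ShiftCoeff q (d i) (f i)) ∧
    ∀ s n k, x (nkKet s n k) = ∑ i, (f i s n k : ℂ) • nkKet s (n + (d i).1) (k + (d i).2)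

lemma ShiftOp.star {q : ℝ} (hq0 : 0 < q) {x : HH →L[ℂ] HH} (hx : ShiftOp q x) :
    ShiftOp q (star x) := by
  obtain ⟨d, f, hf, hxf⟩ := hx
  refine ⟨fun i => -d i, fun i s n k => f i s (n - (d i).1) (k - (d i).2),
    fun i => (hf i).star hq0, fun s n k => ext_inner_nkKet fun s' n' k' => ?_⟩
  rw [ContinuousLinearMap.star_eq_adjoint, ContinuousLinearMap.adjoint_inner_right, hxf,
    sum_inner, inner_sum]
  refine Finset.sum_congr rfl fun i _ => ?_
  rw [inner_smul_left, inner_smul_right, inner_nkKet, inner_nkKet, Complex.conj_ofReal]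
  simp only [Prod.fst_neg, Prod.snd_neg, ← sub_eq_add_neg]
  obtain ⟨-, -, -, -, -, -, h0⟩ := hf i
  by_cases h : s' = s ∧ n' = n - (d i).1 ∧ k' = k - (d i).2
  · obtain ⟨rfl, rfl, rfl⟩ := h
    have := h0 s' (n - (d i).1) (k - (d i).2)
    simp only [sub_add_cancel, not_and] at this ⊢
    by_cases h1 : NKValid (n - (d i).1) (k - (d i).2) <;> by_cases h2 : NKValid n k
    · simp [h1, h2, ← sub_eq_add_neg]
    · simp [this (fun _ => h2)]
    · simp [this (fun h => absurd h h1)]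
    · simp [this (fun h => absurd h h1)]
  · rw [if_neg, if_neg]
    · simp
    · exact fun hh => h hh.2
    · rintro ⟨-, h1, h2, h3⟩
      exact h ⟨h1, by omega, by omega⟩

lemma conj_map_nkKet {J : HH →SL[starRingEnd ℂ] HH}
    (hJ : ∀ (p : Idx) (s : Bool), J (bas p s) = (Complex.I ^ p.1.2) • bas (pFlip p) (!s))
    (s : Bool) (n k : ℤ) : J (nkKet s n k) = Complex.I ^ (n - k) • nkKet (!s) k n := by
  by_cases h : NKValid n k
  · have h' : NKValid k n := ⟨h.2.1, h.1, add_comm n k ▸ h.2.2⟩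
    rw [nkKet_of_valid h, nkKet_of_valid h', hJ]
    congr 2
    simp only [pFlip, neg_sub, Subtype.mk.injEq, Prod.mk.injEq, and_true]
    ring
  · have h' : ¬ NKValid k n := fun h' => h ⟨h'.2.1, h'.1, add_comm k n ▸ h'.2.2⟩
    rw [nkKet_of_not_valid h, nkKet_of_not_valid h', map_zero, smul_zero]

lemma neg_conj_I_zpow_mul {n k : ℤ} (h : Odd (n + k)) (a b : ℤ) :
    -(starRingEnd ℂ (Complex.I ^ (n - k)) * Complex.I ^ (k + a - (n + b))) =
      Complex.I ^ (a - b) := by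
  obtain ⟨r, hr⟩ := h
  rw [map_zpow₀, Complex.conj_I, ← Complex.inv_I, inv_zpow', ← zpow_add₀ Complex.I_ne_zero,
    show -(n - k) + (k + a - (n + b)) = (a - b) + (2 * (2 * (k - r - 1)) + 2) by omega,
    zpow_add₀ Complex.I_ne_zero, zpow_add₀ Complex.I_ne_zero, zpow_mul, zpow_mul]
  norm_num [zpow_ofNat, Complex.I_sq]

/-- Conjugation `y ↦ J y J⁻¹` of operators, where `J⁻¹ = -J`. -/
def conjOp (J : HH →SL[starRingEnd ℂ] HH) (y : HH →L[ℂ] HH) : HH →L[ℂ] HH :=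
  J.comp (y.comp (-J))

lemma conjOp_apply (J : HH →SL[starRingEnd ℂ] HH) (y : HH →L[ℂ] HH) (v : HH) :
    conjOp J y v = J (y (-(J v))) := rfl

lemma conjOp_one {J : HH →SL[starRingEnd ℂ] HH}
    (hJ : ∀ (p : Idx) (s : Bool), J (bas p s) = (Complex.I ^ p.1.2) • bas (pFlip p) (!s)) :
    conjOp J 1 = 1 := by
  refine ext_nkKet fun s n k => ?_
  rw [conjOp_apply, conj_map_nkKet hJ]
  simp only [one_apply_eq_self, map_neg, map_smulₛₗ, conj_map_nkKet hJ, smul_smul,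
    Bool.not_not, RingHom.id_apply]
  by_cases h : NKValid n k
  · have := neg_conj_I_zpow_mul h.2.2 0 0
    rw [add_zero, add_zero, sub_zero, zpow_zero] at this
    rw [← neg_smul, this, one_smul]
  · simp [nkKet_of_not_valid h]

lemma conjOp_mul {J : HH →SL[starRingEnd ℂ] HH}
    (hJ : ∀ (p : Idx) (s : Bool), J (bas p s) = (Complex.I ^ p.1.2) • bas (pFlip p) (!s))
    (y z : HH →L[ℂ] HH) : conjOp J (y * z) = conjOp J y * conjOp J z := by
  ext1 v
  have h : -(J (J (z (-(J v))))) = z (-(J v)) := by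
    have := congrArg (fun T : HH →L[ℂ] HH => T (z (-(J v)))) (conjOp_one hJ)
    simpa [conjOp_apply] using this
  rw [mul_apply_eq_comp, conjOp_apply, conjOp_apply, conjOp_apply, h]
  rfl

lemma conjOp_nkKet {J : HH →SL[starRingEnd ℂ] HH}
    (hJ : ∀ (p : Idx) (s : Bool), J (bas p s) = (Complex.I ^ p.1.2) • bas (pFlip p) (!s))
    {y : HH →L[ℂ] HH} {d : Fin 3 → ℤ × ℤ} {f : Fin 3 → Bool → ℤ → ℤ → ℝ}
    (h0 : ∀ i s n k, ¬ NKValid n k → f i s n k = 0)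
    (hy : ∀ s n k, y (nkKet s n k) =
      ∑ i, (f i s n k : ℂ) • nkKet s (n + (d i).1) (k + (d i).2)) (s : Bool) (n k : ℤ) :
    conjOp J y (nkKet s n k) = ∑ i, (Complex.I ^ ((d i).1 - (d i).2) * f i (!s) k n) •
      nkKet s (n + (d i).2) (k + (d i).1) := by
  rw [conjOp_apply, conj_map_nkKet hJ, ← neg_smul, map_smul, hy, map_smulₛₗ, map_sum,
    Finset.smul_sum]
  refine Finset.sum_congr rfl fun i _ => ?_
  rw [map_smulₛₗ, conj_map_nkKet hJ, smul_smul, smul_smul, Bool.not_not]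
  congr 1
  by_cases h : NKValid k n
  · have := neg_conj_I_zpow_mul (add_comm k n ▸ h.2.2 : Odd (n + k)) (d i).1 (d i).2
    rw [← this, Complex.conj_ofReal, map_neg]
    ring
  · simp [h0 i _ _ _ h]

lemma ShiftOp.isCompactOperator_commutator {q : ℝ} (hq0 : 0 < q) (hq1 : q < 1)
    {J : HH →SL[starRingEnd ℂ] HH}
    (hJ : ∀ (p : Idx) (s : Bool), J (bas p s) = (Complex.I ^ p.1.2) • bas (pFlip p) (!s))
    {x y : HH →L[ℂ] HH} (hx : ShiftOp q x) (hy : ShiftOp q y) :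
    IsCompactOperator (x * conjOp J y - conjOp J y * x) := by
  obtain ⟨d, f, hf, hxf⟩ := hx
  obtain ⟨e, h, hh, hyh⟩ := hy
  choose C hC using fun i j => (hf i).commutator_bound hq0 hq1 (hh j)
  have h0 : ∀ i s n k, ¬ NKValid n k → h i s n k = 0 := by
    intro i s n k hv
    obtain ⟨-, -, -, -, -, -, h0⟩ := hh i
    exact h0 s n k fun hh => hv hh.1
  refine isCompactOperator_of_norm_nkKet_le hq0 hq1 _ (∑ i, ∑ j, C i j) fun s n k hv => ?_
  have key : (x * conjOp J y - conjOp J y * x) (nkKet s n k) = ∑ i, ∑ j,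
      (Complex.I ^ ((e j).1 - (e j).2) *
        ((f i s (n + (e j).2) (k + (e j).1) * h j (!s) k n
          - h j (!s) (k + (d i).2) (n + (d i).1) * f i s n k : ℝ) : ℂ)) •
      nkKet s (n + (d i).1 + (e j).2) (k + (d i).2 + (e j).1) := by
    rw [sub_apply, mul_apply_eq_comp,
      mul_apply_eq_comp, conjOp_nkKet hJ h0 hyh, hxf, map_sum, map_sum]
    simp only [map_smul, conjOp_nkKet hJ h0 hyh, hxf, Finset.smul_sum, smul_smul]
    rw [Finset.sum_comm]
    simp only [← Finset.sum_sub_distrib]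
    refine Finset.sum_congr rfl fun i _ => Finset.sum_congr rfl fun j _ => ?_
    rw [add_right_comm n, add_right_comm k, ← sub_smul]
    congr 1
    push_cast
    ring
  rw [key, Finset.sum_mul]
  refine (norm_sum_le _ _).trans (Finset.sum_le_sum fun i _ => ?_)
  rw [Finset.sum_mul]
  refine (norm_sum_le _ _).trans (Finset.sum_le_sum fun j _ => ?_)
  rw [norm_smul, norm_mul, norm_zpow, Complex.norm_I, one_zpow, one_mul, Complex.norm_real,
    Real.norm_eq_abs]
  exact (mul_le_of_le_one_right (abs_nonneg _) (norm_nkKet_le_one _ _ _)).trans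
    (hC i j s (!s) n k hv)

/-- Operators commuting modulo compacts with a fixed operator form a subalgebra. -/
lemma isCompactOperator_commutator_of_mem_adjoin {A : Type*} [Semiring A] [Algebra ℂ A]
    {E : Type*} [NormedAddCommGroup E] [NormedSpace ℂ E] (φ : A → E →L[ℂ] E)
    (hφ : ∀ r, ∃ t : ℂ, φ (algebraMap ℂ A r) = t • 1) (hadd : ∀ x y, φ (x + y) = φ x + φ y)
    (hmul : ∀ x y, φ (x * y) = φ x * φ y) (S : Set A) (T : E →L[ℂ] E)
    (hS : ∀ x ∈ S, IsCompactOperator (φ x * T - T * φ x)) {x : A}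
    (hx : x ∈ Algebra.adjoin ℂ S) : IsCompactOperator (φ x * T - T * φ x) := by
  induction hx using Algebra.adjoin_induction with
  | mem x hx => exact hS x hx
  | algebraMap r =>
    obtain ⟨t, ht⟩ := hφ r
    rw [ht, smul_one_mul, mul_smul_one, sub_self]
    exact isCompactOperator_zero
  | add x y _ _ hx hy =>
    have : φ (x + y) * T - T * φ (x + y) = (φ x * T - T * φ x) + (φ y * T - T * φ y) := by
      rw [hadd]; noncomm_ring
    rw [this]
    exact hx.add hy
  | mul x y _ _ hx hy =>
    have : φ (x * y) * T - T * φ (x * y)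
        = φ x * (φ y * T - T * φ y) + (φ x * T - T * φ x) * φ y := by
      rw [hmul]; noncomm_ring
    rw [this]
    exact (hy.clm_comp (φ x)).add (hx.comp_clm (φ y))

/-- The factor `1 - q ^ (2 x)` of the `q`-number `[x]`. -/
def qU (q x : ℝ) : ℝ := 1 - q ^ (2 * x)

section Coefficients

variable {q : ℝ}

lemma qU_le_one (hq0 : 0 < q) (x : ℝ) : qU q x ≤ 1 := by
  have : 0 < q ^ (2 * x) := by positivity
  unfold qU
  linarith

lemma qU_nonneg (hq0 : 0 < q) (hq1 : q < 1) {x : ℝ} (hx : 0 ≤ x) : 0 ≤ qU q x :=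
  sub_nonneg.2 (Real.rpow_le_one hq0.le hq1.le (by positivity))

lemma qU_zero : qU q 0 = 0 := by simp [qU]

lemma one_sub_sq_le_qU (hq0 : 0 < q) (hq1 : q < 1) {x : ℝ} (hx : 1 ≤ x) :
    1 - q ^ 2 ≤ qU q x := by
  have := Real.rpow_le_rpow_of_exponent_ge hq0 hq1.le (show (2 : ℝ) ≤ 2 * x by linarith)
  rw [Real.rpow_two] at this
  unfold qU
  linarith

lemma one_sub_sq_pos (hq0 : 0 < q) (hq1 : q < 1) : 0 < 1 - q ^ 2 := by nlinarith

lemma qn_eq_rpow_mul_qU (hq0 : 0 < q) (x : ℝ) :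
    qn q x = q ^ (-x) * qU q x / (q⁻¹ - q) := by
  have h : q ^ (-x) * q ^ (2 * x) = q ^ x := by
    rw [← Real.rpow_add hq0]; ring_nf
  unfold qn qU
  rw [mul_sub, h, mul_one, ← neg_sub (q ^ (-x)), ← neg_sub q⁻¹, neg_div_neg_eq]

lemma rpow_div_qn_mul_sqrt (hq0 : 0 < q) (hq1 : q < 1) (α X x y : ℝ) :
    q ^ α / qn q X * √(qn q x * qn q y) =
      q ^ (α + X - (x + y) / 2) * (√(qU q x * qU q y) / qU q X) := by
  have hD := inv_sub_self_pos hq0 hq1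
  have h1 : qn q x * qn q y =
      (q ^ (-(x + y) / 2) / (q⁻¹ - q)) ^ 2 * (qU q x * qU q y) := by
    have : (q ^ (-(x + y) / 2)) ^ 2 = q ^ (-x) * q ^ (-y) := by
      rw [sq, ← Real.rpow_add hq0, ← Real.rpow_add hq0]; ring_nf
    rw [qn_eq_rpow_mul_qU hq0, qn_eq_rpow_mul_qU hq0, div_pow, this,
      div_mul_div_comm, ← sq, div_mul_eq_mul_div]
    ring
  rw [h1, Real.sqrt_mul (sq_nonneg _), Real.sqrt_sq (by positivity), qn_eq_rpow_mul_qU hq0,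
    show α + X - (x + y) / 2 = α + (-(-X)) + (-(x + y) / 2) by ring, Real.rpow_add hq0,
    Real.rpow_add hq0, Real.rpow_neg hq0.le (-X)]
  generalize q⁻¹ - q = D at hD
  field_simp

lemma aC2_eq_s7 (hq0 : 0 < q) (hq1 : q < 1) (n k : ℝ) :
    aC2 q ((n + k) / 2) ((n - k) / 2) =
      √(qU q (n + 1) * qU q (n + 2)) / qU q (n + k + 2) := by
  unfold aC2
  rw [rpow_div_qn_mul_sqrt hq0 hq1]
  ring_nf
  simp

lemma aC3_eq_s7 (hq0 : 0 < q) (hq1 : q < 1) (n k : ℝ) :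
    aC3 q ((n + k) / 2) ((n - k) / 2) =
      q ^ (2 * n + 1) * (√(qU q k * qU q (k - 1)) / qU q (n + k)) := by
  unfold aC3
  rw [rpow_div_qn_mul_sqrt hq0 hq1]
  ring_nf

lemma bC2_eq_s7 (hq0 : 0 < q) (hq1 : q < 1) (n k : ℝ) :
    bC2 q ((n + k) / 2) ((n - k) / 2) =
      q ^ (n + 2) * (√(qU q (k + 1) * qU q (n + 1)) / qU q (n + k + 2)) := by
  unfold bC2
  rw [rpow_div_qn_mul_sqrt hq0 hq1]
  ring_nf

lemma bC3_eq_s7 (hq0 : 0 < q) (hq1 : q < 1) (n k : ℝ) :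
    bC3 q ((n + k) / 2) ((n - k) / 2) =
      q ^ (n + 1) * (√(qU q k * qU q n) / qU q (n + k)) := by
  unfold bC3
  rw [rpow_div_qn_mul_sqrt hq0 hq1]
  ring_nf

lemma abs_sgn (s : Bool) : |sgn s| = 1 := by cases s <;> simp [sgn]

lemma abs_aC1_le_s7 (hq0 : 0 < q) (hq1 : q < 1) (s : Bool) {n k : ℝ} (hn : 0 ≤ n) (hk : 0 ≤ k)
    (hnk : 1 ≤ n + k) :
    |aC1 q (sgn s) ((n + k) / 2) ((n - k) / 2)| ≤
      (1 + q ^ 2) * (q⁻¹ - q) / (1 - q ^ 2) ^ 2 * q ^ (n + k) := by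
  have hD := inv_sub_self_pos hq0 hq1
  have hw := one_sub_sq_pos hq0 hq1
  have h1 := one_sub_sq_le_qU hq0 hq1 hnk
  have h2 := one_sub_sq_le_qU hq0 hq1 (show 1 ≤ n + k + 2 by linarith)
  have h3 : √(qU q (n + 1) * qU q k) ≤ 1 := Real.sqrt_le_one.2
    (mul_le_one₀ (qU_le_one hq0 _) (qU_nonneg hq0 hq1 hk) (qU_le_one hq0 _))
  have e1 : aC1 q (sgn s) ((n + k) / 2) ((n - k) / 2) = sgn s * ((1 + q ^ 2) * (q⁻¹ - q) *
      (q ^ (2 * n + k + 1) * (√(qU q (n + 1) * qU q k) / (qU q (n + k) * qU q (n + k + 2))))) := by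
    have hr := rpow_div_qn_mul_sqrt hq0 hq1 ((n - k) / 2 - 1 / 2) (n + k) (n + 1) k
    have hs : q ^ (2 * n + k + 1) =
        q ^ ((n - k) / 2 - 1 / 2 + (n + k) - (n + 1 + k) / 2) * (q ^ (-(n + k + 2)))⁻¹ := by
      rw [← Real.rpow_neg hq0.le, ← Real.rpow_add hq0]
      ring_nf
    rw [hs]
    unfold aC1
    rw [show 2 * ((n + k) / 2) = n + k by ring, show (n + k) / 2 + (n - k) / 2 = n by ring,
      show (n + k) / 2 - (n - k) / 2 = k by ring, ← div_div, mul_assoc, div_mul_eq_mul_div, hr,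
      qn_eq_rpow_mul_qU hq0 (n + k + 2)]
    field_simp
  have hN1 := hw.trans_le h1
  have hN2 := hw.trans_le h2
  have h4 : √(qU q (n + 1) * qU q k) / (qU q (n + k) * qU q (n + k + 2)) ≤
      1 / (1 - q ^ 2) ^ 2 := by
    rw [sq (1 - q ^ 2)]
    gcongr
  have h5 : q ^ (2 * n + k + 1) ≤ q ^ (n + k) :=
    Real.rpow_le_rpow_of_exponent_ge hq0 hq1.le (by linarith)
  rw [e1, abs_mul, abs_sgn, one_mul, abs_of_nonneg (by positivity),
    show (1 + q ^ 2) * (q⁻¹ - q) / (1 - q ^ 2) ^ 2 * q ^ (n + k) =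
      (1 + q ^ 2) * (q⁻¹ - q) * (q ^ (n + k) * (1 / (1 - q ^ 2) ^ 2)) by ring]
  gcongr

lemma abs_bC1_le_s7 (hq0 : 0 < q) (hq1 : q < 1) (s : Bool) {n k : ℝ} (hn : 0 ≤ n) (hk : 0 ≤ k)
    (hnk : 1 ≤ n + k) :
    |bC1 q (sgn s) ((n + k) / 2) ((n - k) / 2)| ≤ 2 / (1 - q ^ 2) ^ 2 * q ^ (n + k) := by
  have hD := inv_sub_self_pos hq0 hq1
  have hw := one_sub_sq_pos hq0 hq1
  have h1 := one_sub_sq_le_qU hq0 hq1 hnk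
  have h2 := one_sub_sq_le_qU hq0 hq1 (show 1 ≤ n + k + 2 by linarith)
  have hN1 := hw.trans_le h1
  have hN2 := hw.trans_le h2
  have e1 : bC1 q (sgn s) ((n + k) / 2) ((n - k) / 2) = sgn s * (q ^ (n + k + 1) *
      ((qU q (k + 1) * qU q n - q ^ 2 * (qU q k * qU q (n + 1))) /
        (qU q (n + k) * qU q (n + k + 2)))) := by
    have t1 : q ^ (-(k + 1)) * q ^ (-n) = (q ^ (n + k + 1))⁻¹ := by
      rw [← Real.rpow_add hq0, ← Real.rpow_neg hq0.le]; ring_nf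
    have t2 : q ^ (-k) * q ^ (-(n + 1)) = (q ^ (n + k + 1))⁻¹ := by
      rw [← Real.rpow_add hq0, ← Real.rpow_neg hq0.le]; ring_nf
    have t3 : q ^ (-(n + k)) * q ^ (-(n + k + 2)) = (q ^ (n + k + 1) * q ^ (n + k + 1))⁻¹ := by
      rw [← Real.rpow_add hq0, ← Real.rpow_add hq0, ← Real.rpow_neg hq0.le]; ring_nf
    unfold bC1
    rw [show 2 * ((n + k) / 2) = n + k by ring, show (n + k) / 2 + (n - k) / 2 = n by ring,
      show (n + k) / 2 - (n - k) / 2 = k by ring]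
    simp only [qn_eq_rpow_mul_qU hq0, div_mul_div_comm, mul_mul_mul_comm _ (qU q _), t1, t2, t3]
    have hp : 0 < q ^ (n + k + 1) := by positivity
    generalize q⁻¹ - q = D at hD
    field_simp
  have a1 : |qU q (k + 1) * qU q n - q ^ 2 * (qU q k * qU q (n + 1))| ≤ 2 := by
    have b1 : 0 ≤ qU q (k + 1) * qU q n :=
      mul_nonneg (qU_nonneg hq0 hq1 (by linarith)) (qU_nonneg hq0 hq1 hn)
    have b2 : 0 ≤ qU q k * qU q (n + 1) :=
      mul_nonneg (qU_nonneg hq0 hq1 hk) (qU_nonneg hq0 hq1 (by linarith))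
    have b3 : qU q (k + 1) * qU q n ≤ 1 :=
      mul_le_one₀ (qU_le_one hq0 _) (qU_nonneg hq0 hq1 hn) (qU_le_one hq0 _)
    have b4 : qU q k * qU q (n + 1) ≤ 1 :=
      mul_le_one₀ (qU_le_one hq0 _) (qU_nonneg hq0 hq1 (by linarith)) (qU_le_one hq0 _)
    rw [abs_le]
    constructor <;> nlinarith [mul_nonneg hw.le b2]
  have h5 : q ^ (n + k + 1) ≤ q ^ (n + k) :=
    Real.rpow_le_rpow_of_exponent_ge hq0 hq1.le (by linarith)
  rw [e1, abs_mul, abs_sgn, one_mul, abs_mul, abs_div,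
    abs_of_pos (mul_pos hN1 hN2), abs_of_nonneg (by positivity : 0 ≤ q ^ (n + k + 1)),
    mul_comm, sq (1 - q ^ 2)]
  gcongr

lemma abs_sqrt_sub_one_le {s : ℝ} (hs : 0 ≤ s) (hs1 : s ≤ 1) : |√s - 1| ≤ 1 - s := by
  have h1 := Real.sqrt_le_one.2 hs1
  have h2 := Real.sqrt_nonneg s
  have h3 := Real.sq_sqrt hs
  rw [abs_le]
  constructor <;> nlinarith

/-- If `s` and `U` are close to `1`, so is `√s / U`. -/
lemma abs_sqrt_div_sub_one_le {w s U δ : ℝ} (hw : 0 < w) (hs : 0 ≤ s) (hs1 : s ≤ 1)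
    (hU : w ≤ U) (hU1 : U ≤ 1) (hδ : (1 - s) + (1 - U) ≤ δ) : |√s / U - 1| ≤ δ / w := by
  have hU0 := hw.trans_le hU
  have h1 : |√s - U| ≤ δ := by
    have h2 := abs_le.1 (abs_sqrt_sub_one_le hs hs1)
    rw [abs_le]
    constructor <;> linarith
  rw [div_sub_one hU0.ne', abs_div, abs_of_pos hU0]
  have := (abs_nonneg _).trans h1
  gcongr

lemma abs_aC2_sub_le (hq0 : 0 < q) (hq1 : q < 1) {n k : ℝ} (hn : 0 ≤ n) (hk : 0 ≤ k) :
    |aC2 q ((n + k) / 2) ((n - k) / 2) - √(qU q (n + 1) * qU q (n + 2))| ≤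
      1 / (1 - q ^ 2) * q ^ (n + k) := by
  have hw := one_sub_sq_pos hq0 hq1
  have h2 := one_sub_sq_le_qU hq0 hq1 (show 1 ≤ n + k + 2 by linarith)
  have h3 : √(qU q (n + 1) * qU q (n + 2)) ≤ 1 := Real.sqrt_le_one.2
    (mul_le_one₀ (qU_le_one hq0 _) (qU_nonneg hq0 hq1 (by linarith)) (qU_le_one hq0 _))
  have h4 : |√1 / qU q (n + k + 2) - 1| ≤ q ^ (n + k) / (1 - q ^ 2) := by
    refine abs_sqrt_div_sub_one_le hw zero_le_one le_rfl h2 (qU_le_one hq0 _) ?_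
    have := Real.rpow_le_rpow_of_exponent_ge hq0 hq1.le
      (show n + k ≤ 2 * (n + k + 2) by linarith)
    unfold qU
    linarith
  rw [aC2_eq_s7 hq0 hq1, show √(qU q (n + 1) * qU q (n + 2)) / qU q (n + k + 2) -
    √(qU q (n + 1) * qU q (n + 2)) = √(qU q (n + 1) * qU q (n + 2)) *
      (√1 / qU q (n + k + 2) - 1) by rw [Real.sqrt_one]; ring, abs_mul,
    abs_of_nonneg (Real.sqrt_nonneg _)]
  refine (mul_le_mul h3 h4 (abs_nonneg _) zero_le_one).trans (le_of_eq ?_)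
  ring

lemma abs_aC3_sub_le (hq0 : 0 < q) (hq1 : q < 1) {n k : ℝ} (hn : 0 ≤ n)
    (hk : k = 0 ∨ 1 ≤ k) (hnk : 1 ≤ n + k) :
    |aC3 q ((n + k) / 2) ((n - k) / 2) - q ^ (2 * n + 1)| ≤ 3 / (1 - q ^ 2) * q ^ (n + k) := by
  have hw := one_sub_sq_pos hq0 hq1
  have h1 := one_sub_sq_le_qU hq0 hq1 hnk
  have hs : 0 ≤ qU q k * qU q (k - 1) ∧ qU q k * qU q (k - 1) ≤ 1 := by
    rcases hk with rfl | hk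
    · simp [qU_zero]
    · have a1 := qU_nonneg hq0 hq1 (show 0 ≤ k by linarith)
      have a2 := qU_nonneg hq0 hq1 (show 0 ≤ k - 1 by linarith)
      exact ⟨mul_nonneg a1 a2, mul_le_one₀ (qU_le_one hq0 _) a2 (qU_le_one hq0 _)⟩
  have h4 : |√(qU q k * qU q (k - 1)) / qU q (n + k) - 1| ≤
      (q ^ (2 * k) + q ^ (2 * (k - 1)) + q ^ (2 * (n + k))) / (1 - q ^ 2) := by
    refine abs_sqrt_div_sub_one_le hw hs.1 hs.2 h1 (qU_le_one hq0 _) ?_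
    have a1 : 0 < q ^ (2 * k) * q ^ (2 * (k - 1)) := by positivity
    unfold qU
    nlinarith
  have p : ∀ {x : ℝ}, 2 * (k - 1) ≤ x → q ^ (2 * n + 1) * q ^ x ≤ q ^ (n + k) := by
    intro x hx
    rw [← Real.rpow_add hq0]
    exact Real.rpow_le_rpow_of_exponent_ge hq0 hq1.le (by linarith)
  have p1 := p (show 2 * (k - 1) ≤ 2 * k by linarith)
  have p2 := p (le_refl (2 * (k - 1)))
  have p3 := p (show 2 * (k - 1) ≤ 2 * (n + k) by linarith)
  rw [aC3_eq_s7 hq0 hq1, ← mul_sub_one, abs_mul, abs_of_nonneg (by positivity)]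
  refine (mul_le_mul_of_nonneg_left h4 (by positivity)).trans ?_
  rw [← mul_div_assoc, div_mul_eq_mul_div]
  exact div_le_div_of_nonneg_right (by linarith) hw.le

lemma abs_bC2_sub_le (hq0 : 0 < q) (hq1 : q < 1) {n k : ℝ} (hn : 0 ≤ n) (hk : 0 ≤ k) :
    |bC2 q ((n + k) / 2) ((n - k) / 2) - q ^ (n + 2) * √(qU q (n + 1))| ≤
      2 / (1 - q ^ 2) * q ^ (n + k) := by
  have hw := one_sub_sq_pos hq0 hq1
  have h1 := one_sub_sq_le_qU hq0 hq1 (show 1 ≤ n + k + 2 by linarith)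
  have h3 : √(qU q (n + 1)) ≤ 1 := Real.sqrt_le_one.2 (qU_le_one hq0 _)
  have h0 := qU_nonneg hq0 hq1 (show 0 ≤ k + 1 by linarith)
  have h4 : |√(qU q (k + 1)) / qU q (n + k + 2) - 1| ≤ (2 * q ^ k) / (1 - q ^ 2) := by
    refine abs_sqrt_div_sub_one_le hw h0 (qU_le_one hq0 _) h1 (qU_le_one hq0 _) ?_
    have a1 := Real.rpow_le_rpow_of_exponent_ge hq0 hq1.le
      (show k ≤ 2 * (n + k + 2) by linarith)
    have a2 := Real.rpow_le_rpow_of_exponent_ge hq0 hq1.le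
      (show k ≤ 2 * (k + 1) by linarith)
    unfold qU
    linarith
  rw [bC2_eq_s7 hq0 hq1, Real.sqrt_mul h0, show q ^ (n + 2) * (√(qU q (k + 1)) * √(qU q (n + 1)) /
    qU q (n + k + 2)) - q ^ (n + 2) * √(qU q (n + 1)) = q ^ (n + 2) * √(qU q (n + 1)) *
      (√(qU q (k + 1)) / qU q (n + k + 2) - 1) by ring, abs_mul, abs_of_nonneg (by positivity)]
  have h5 := Real.rpow_le_rpow_of_exponent_ge hq0 hq1.le (show n ≤ n + 2 by linarith)
  calc _ ≤ q ^ n * 1 * ((2 * q ^ k) / (1 - q ^ 2)) := by gcongr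
    _ = _ := by rw [Real.rpow_add hq0]; ring

lemma abs_bC3_sub_le (hq0 : 0 < q) (hq1 : q < 1) {n k : ℝ} (hn : 0 ≤ n) (hk : 0 ≤ k)
    (hnk : 1 ≤ n + k) :
    |bC3 q ((n + k) / 2) ((n - k) / 2) - q ^ (n + 1) * √(qU q n)| ≤
      2 / (1 - q ^ 2) * q ^ (n + k) := by
  have hw := one_sub_sq_pos hq0 hq1
  have h1 := one_sub_sq_le_qU hq0 hq1 hnk
  have h3 : √(qU q n) ≤ 1 := Real.sqrt_le_one.2 (qU_le_one hq0 _)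
  have h0 := qU_nonneg hq0 hq1 hk
  have h4 : |√(qU q k) / qU q (n + k) - 1| ≤ (2 * q ^ k) / (1 - q ^ 2) := by
    refine abs_sqrt_div_sub_one_le hw h0 (qU_le_one hq0 _) h1 (qU_le_one hq0 _) ?_
    have a1 := Real.rpow_le_rpow_of_exponent_ge hq0 hq1.le
      (show k ≤ 2 * (n + k) by linarith)
    have a2 := Real.rpow_le_rpow_of_exponent_ge hq0 hq1.le
      (show k ≤ 2 * k by linarith)
    unfold qU
    linarith
  rw [bC3_eq_s7 hq0 hq1, Real.sqrt_mul h0, show q ^ (n + 1) * (√(qU q k) * √(qU q n) /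
    qU q (n + k)) - q ^ (n + 1) * √(qU q n) = q ^ (n + 1) * √(qU q n) *
      (√(qU q k) / qU q (n + k) - 1) by ring, abs_mul, abs_of_nonneg (by positivity)]
  have h5 := Real.rpow_le_rpow_of_exponent_ge hq0 hq1.le (show n ≤ n + 1 by linarith)
  calc _ ≤ q ^ n * 1 * ((2 * q ^ k) / (1 - q ^ 2)) := by gcongr
    _ = _ := by rw [Real.rpow_add hq0]; ring

end Coefficients

/-- The extension by zero of the coefficient of a shift by `d` to all integer arguments. -/
def extendCoeff (d : ℤ × ℤ) (F : Bool → ℝ → ℝ → ℝ) (s : Bool) (n k : ℤ) : ℝ :=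
  open Classical in if NKValid n k ∧ NKValid (n + d.1) (k + d.2) then F s n k else 0

lemma shiftCoeff_extendCoeff {q : ℝ} (hq0 : 0 < q) (hq1 : q < 1) {d : ℤ × ℤ}
    (hd : Even (d.1 + d.2)) {F : Bool → ℝ → ℝ → ℝ} (c : ℝ) (g : ℝ → ℝ) (hc : c ≠ 0 → d.2 = 0)
    (C₁ C₂ C₃ C₄ : ℝ) (hg : ∀ n : ℝ, 0 ≤ n → |g n| ≤ C₁ * q ^ n)
    (hF : ∀ (s : Bool) (n k : ℤ), NKValid n k →
      |F s n k - (c + g n)| ≤ C₂ * q ^ ((n : ℝ) + k))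
    (hout : ∀ n k : ℤ, NKValid n k → n + d.1 < 0 ∨ k + d.2 < 0 →
      |c + g n| ≤ C₃ * q ^ ((n : ℝ) + k))
    (hin : ∀ n k : ℤ, 0 ≤ n → k < 0 → 0 ≤ k + d.2 → |c + g n| ≤ C₄ * q ^ ((n : ℝ) + k)) :
    ShiftCoeff q d (extendCoeff d F) := by
  have hle : ∀ {D x : ℝ}, 0 ≤ x → |D| ≤ |c| + |C₁| + |C₂| + |C₃| + |C₄| →
      D * x ≤ (|c| + |C₁| + |C₂| + |C₃| + |C₄|) * x := fun hx hD =>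
    mul_le_mul_of_nonneg_right ((le_abs_self _).trans hD) hx
  have c0 := abs_nonneg c
  have c1 := abs_nonneg C₁
  have c2 := abs_nonneg C₂
  have c3 := abs_nonneg C₃
  have c4 := abs_nonneg C₄
  refine ⟨c, fun n => if 0 ≤ n then g n else -c, |c| + |C₁| + |C₂| + |C₃| + |C₄|, hc,
    fun n => ?_, fun s n k hv => ?_, fun s n k hv => if_neg hv⟩
  · beta_reduce
    rw [← Real.rpow_intCast]
    have hp : 0 ≤ q ^ (n : ℝ) := by positivity
    split_ifs with hn
    · exact (hg n (by exact_mod_cast hn)).trans (hle hp (by linarith))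
    · rw [abs_neg]
      have h1 : 1 ≤ q ^ (n : ℝ) := Real.one_le_rpow_of_pos_of_le_one_of_nonpos hq0 hq1.le
        (by exact_mod_cast (not_le.1 hn).le)
      have h2 : |c| ≤ |c| * q ^ (n : ℝ) := le_mul_of_one_le_right c0 h1
      exact h2.trans (hle hp (by rw [abs_abs]; linarith))
  · rw [← Real.rpow_intCast, Int.cast_add]
    have hp : 0 ≤ q ^ ((n : ℝ) + k) := by positivity
    have hpar : Odd (n + k) ↔ Odd (n + d.1 + (k + d.2)) := by
      rw [show n + d.1 + (k + d.2) = n + k + (d.1 + d.2) by ring]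
      simp [Int.odd_add, hd]
    unfold extendCoeff
    beta_reduce
    by_cases h1 : NKValid n k
    · rw [if_pos h1.1]
      by_cases h2 : NKValid (n + d.1) (k + d.2)
      · rw [if_pos ⟨h1, h2⟩]
        exact (hF s n k h1).trans (hle hp (by linarith))
      · rw [if_neg fun h => h2 h.2, zero_sub, abs_neg]
        refine (hout n k h1 ?_).trans (hle hp (by linarith))
        by_contra! h
        exact h2 ⟨h.1, h.2, hpar.1 h1.2.2⟩
    · have h2 := hv.resolve_left h1
      rw [if_neg fun h => h1 h.1]
      split_ifs with hn
      · rw [zero_sub, abs_neg]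
        refine (hin n k hn ?_ h2.2.1).trans (hle hp (by linarith))
        by_contra! h
        exact h1 ⟨hn, h, hpar.2 h2.2.2⟩
      · simpa using mul_nonneg (by positivity) hp

/-- A coefficient that is itself of order `q ^ (n + k)`. -/
lemma shiftCoeff_extendCoeff_of_le {q : ℝ} (hq0 : 0 < q) (hq1 : q < 1) {d : ℤ × ℤ}
    (hd : Even (d.1 + d.2)) {F : Bool → ℝ → ℝ → ℝ} (C : ℝ)
    (hF : ∀ (s : Bool) (n k : ℤ), NKValid n k → |F s n k| ≤ C * q ^ ((n : ℝ) + k)) :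
    ShiftCoeff q d (extendCoeff d F) :=
  shiftCoeff_extendCoeff hq0 hq1 hd 0 (fun _ => 0) (by simp) 0 C 0 0 (by simp)
    (by simpa using hF) (by simp) (by simp)

lemma NKValid.cast {n k : ℤ} (h : NKValid n k) :
    (0 : ℝ) ≤ n ∧ (0 : ℝ) ≤ k ∧ (1 : ℝ) ≤ (n : ℝ) + k := by
  obtain ⟨h1, h2, r, h3⟩ := h
  exact ⟨by exact_mod_cast h1, by exact_mod_cast h2,
    by exact_mod_cast (by omega : 1 ≤ n + k)⟩

/-- An operator given on the basis by three shifts with coefficients extended by zero. -/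
lemma shiftOp_of_nkKet {q : ℝ} {x : HH →L[ℂ] HH} (d : Fin 3 → ℤ × ℤ)
    (F : Fin 3 → Bool → ℝ → ℝ → ℝ) (hF : ∀ i, ShiftCoeff q (d i) (extendCoeff (d i) (F i)))
    (hx : ∀ s n k, NKValid n k → x (nkKet s n k) =
      ∑ i, (F i s n k : ℂ) • nkKet s (n + (d i).1) (k + (d i).2)) : ShiftOp q x := by
  refine ⟨d, _, hF, fun s n k => ?_⟩
  by_cases h : NKValid n k
  · rw [hx s n k h]
    refine Finset.sum_congr rfl fun i _ => ?_
    by_cases h' : NKValid (n + (d i).1) (k + (d i).2)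
    · rw [extendCoeff, if_pos ⟨h, h'⟩]
    · rw [nkKet_of_not_valid h', smul_zero, smul_zero]
  · simp [nkKet_of_not_valid h, extendCoeff, h]

lemma shiftOp_of_aVal2 {q : ℝ} (hq0 : 0 < q) (hq1 : q < 1) {πa : HH →L[ℂ] HH}
    (hπa : ∀ (p : Idx) (s : Bool), πa (bas p s) = aVal2 q s p.1.1 p.1.2) : ShiftOp q πa := by
  have hmono {x y : ℝ} (h : x ≤ y) : q ^ y ≤ q ^ x :=
    Real.rpow_le_rpow_of_exponent_ge hq0 hq1.le h
  refine shiftOp_of_nkKet ![(1, -1), (2, 0), (0, -2)]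
    ![fun s n k => aC1 q (sgn s) ((n + k) / 2) ((n - k) / 2),
      fun _ n k => aC2 q ((n + k) / 2) ((n - k) / 2),
      fun _ n k => -aC3 q ((n + k) / 2) ((n - k) / 2)] ?_ ?_
  · intro i
    fin_cases i
    · exact shiftCoeff_extendCoeff_of_le hq0 hq1 (by decide) _ fun s n k h =>
        abs_aC1_le_s7 hq0 hq1 s h.cast.1 h.cast.2.1 h.cast.2.2
    · refine shiftCoeff_extendCoeff hq0 hq1 (by decide) 1
        (fun n => √(qU q (n + 1) * qU q (n + 2)) - 1) (fun _ => rfl) 2 (1 / (1 - q ^ 2)) 0 0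
        (fun n hn => ?_) (fun s n k h => ?_) (fun n k h h' => ?_) (fun n k hn hk h => ?_)
      · have b1 := qU_nonneg hq0 hq1 (show 0 ≤ n + 1 by linarith)
        have b2 := qU_nonneg hq0 hq1 (show 0 ≤ n + 2 by linarith)
        refine (abs_sqrt_sub_one_le (mul_nonneg b1 b2)
          (mul_le_one₀ (qU_le_one hq0 _) b2 (qU_le_one hq0 _))).trans ?_
        have a1 := hmono (show n ≤ 2 * (n + 1) by linarith)
        have a2 := hmono (show n ≤ 2 * (n + 2) by linarith)
        have a3 : 0 < q ^ (2 * (n + 1)) * q ^ (2 * (n + 2)) := by positivity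
        unfold qU
        nlinarith
      · rw [add_sub_cancel]
        exact abs_aC2_sub_le hq0 hq1 h.cast.1 h.cast.2.1
      · have h1 := h.1
        have h2 := h.2.1
        simp at h'
        omega
      · simp at h
        omega
    · refine shiftCoeff_extendCoeff hq0 hq1 (by decide) 0 (fun n => -q ^ (2 * n + 1))
        (by simp) 1 (3 / (1 - q ^ 2)) (q ^ (-1 : ℝ)) 0
        (fun n hn => ?_) (fun s n k h => ?_) (fun n k h h' => ?_) (fun n k hn hk h => ?_)
      · rw [abs_neg, abs_of_nonneg (by positivity), one_mul]
        exact hmono (by linarith)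
      · show |-aC3 q (((n : ℝ) + k) / 2) (((n : ℝ) - k) / 2) - (0 + -q ^ (2 * (n : ℝ) + 1))| ≤ _
        rw [zero_add, ← neg_sub', abs_neg]
        refine abs_aC3_sub_le hq0 hq1 h.cast.1 ?_ h.cast.2.2
        rcases h.2.1.eq_or_lt with h' | h'
        · exact Or.inl (by exact_mod_cast h'.symm)
        · exact Or.inr (by exact_mod_cast h')
      · have hk : (k : ℝ) ≤ 1 := by
          have h1 := h.1
          simp at h'
          exact_mod_cast (by omega : k ≤ 1)
        have hn := h.cast.1
        rw [zero_add, abs_neg, abs_of_nonneg (by positivity), ← Real.rpow_add hq0]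
        exact hmono (by linarith)
      · simp at h
        omega
  · intro s n k h
    rw [nkKet_of_valid h, hπa, aVal2, Fin.sum_univ_three]
    simp only [nkKet, Matrix.cons_val_zero, Matrix.cons_val_one, Matrix.cons_val]
    push_cast
    rw [neg_smul, ← sub_eq_add_neg]
    ring_nf

lemma shiftOp_of_bVal2 {q : ℝ} (hq0 : 0 < q) (hq1 : q < 1) {πb : HH →L[ℂ] HH}
    (hπb : ∀ (p : Idx) (s : Bool), πb (bas p s) = bVal2 q s p.1.1 p.1.2) : ShiftOp q πb := by
  have hmono {x y : ℝ} (h : x ≤ y) : q ^ y ≤ q ^ x :=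
    Real.rpow_le_rpow_of_exponent_ge hq0 hq1.le h
  have hsqrt (x : ℝ) : √(qU q x) ≤ 1 := Real.sqrt_le_one.2 (qU_le_one hq0 _)
  refine shiftOp_of_nkKet ![(0, 0), (1, 1), (-1, -1)]
    ![fun s n k => bC1 q (sgn s) ((n + k) / 2) ((n - k) / 2),
      fun _ n k => -bC2 q ((n + k) / 2) ((n - k) / 2),
      fun _ n k => -bC3 q ((n + k) / 2) ((n - k) / 2)] ?_ ?_
  · intro i
    fin_cases i
    · exact shiftCoeff_extendCoeff_of_le hq0 hq1 (by decide) _ fun s n k h =>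
        abs_bC1_le_s7 hq0 hq1 s h.cast.1 h.cast.2.1 h.cast.2.2
    · refine shiftCoeff_extendCoeff hq0 hq1 (by decide) 0
        (fun n => -(q ^ (n + 2) * √(qU q (n + 1)))) (by simp) 1 (2 / (1 - q ^ 2)) 0 1
        (fun n hn => ?_) (fun s n k h => ?_) (fun n k h h' => ?_) (fun n k hn hk h => ?_)
      · rw [abs_neg, abs_of_nonneg (by positivity), one_mul]
        exact (mul_le_of_le_one_right (by positivity) (hsqrt _)).trans (hmono (by linarith))
      · show |-bC2 q (((n : ℝ) + k) / 2) (((n : ℝ) - k) / 2) -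
          (0 + -(q ^ ((n : ℝ) + 2) * √(qU q (n + 1))))| ≤ _
        rw [zero_add, ← neg_sub', abs_neg]
        exact abs_bC2_sub_le hq0 hq1 h.cast.1 h.cast.2.1
      · have h1 := h.1
        have h2 := h.2.1
        simp at h'
        omega
      · have hk' : (k : ℝ) ≤ 0 := by exact_mod_cast hk.le
        rw [zero_add, abs_neg, abs_of_nonneg (by positivity), one_mul]
        exact (mul_le_of_le_one_right (by positivity) (hsqrt _)).trans (hmono (by linarith))
    · refine shiftCoeff_extendCoeff hq0 hq1 (by decide) 0
        (fun n => -(q ^ (n + 1) * √(qU q n))) (by simp) 1 (2 / (1 - q ^ 2)) 1 0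
        (fun n hn => ?_) (fun s n k h => ?_) (fun n k h h' => ?_) (fun n k hn hk h => ?_)
      · rw [abs_neg, abs_of_nonneg (by positivity), one_mul]
        exact (mul_le_of_le_one_right (by positivity) (hsqrt _)).trans (hmono (by linarith))
      · show |-bC3 q (((n : ℝ) + k) / 2) (((n : ℝ) - k) / 2) -
          (0 + -(q ^ ((n : ℝ) + 1) * √(qU q n)))| ≤ _
        rw [zero_add, ← neg_sub', abs_neg]
        exact abs_bC3_sub_le hq0 hq1 h.cast.1 h.cast.2.1 h.cast.2.2
      · have hnk : n = 0 ∨ k = 0 := by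
          have h1 := h.1
          have h2 := h.2.1
          simp at h'
          omega
        rcases hnk with rfl | rfl
        · simp only [Int.cast_zero, qU_zero, Real.sqrt_zero, mul_zero, neg_zero, add_zero,
            abs_zero]
          positivity
        · rw [zero_add, abs_neg, abs_of_nonneg (by positivity), one_mul]
          exact (mul_le_of_le_one_right (by positivity) (hsqrt _)).trans (hmono (by simp))
      · simp at h
        omega
  · intro s n k h
    rw [nkKet_of_valid h, hπb, bVal2, Fin.sum_univ_three]
    simp only [nkKet, Matrix.cons_val_zero, Matrix.cons_val_one, Matrix.cons_val]
    push_cast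
    rw [neg_smul, neg_smul, ← sub_eq_add_neg, ← sub_eq_add_neg]
    ring_nf

/-- `J` maps the algebra `A` into its commutant modulo compact operators:
for all `x, y ∈ A`, the commutator `[x, JyJ⁻¹]` is compact (recall `J⁻¹ = -J`). -/
theorem statement7 (q : ℝ) (hq0 : 0 < q) (hq1 : q < 1)
    (πa πb : HH →L[ℂ] HH)
    (hπa : ∀ (p : Idx) (s : Bool), πa (bas p s) = aVal2 q s p.1.1 p.1.2)
    (hπb : ∀ (p : Idx) (s : Bool), πb (bas p s) = bVal2 q s p.1.1 p.1.2)
    (J : HH →SL[starRingEnd ℂ] HH)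
    (hJ : ∀ (p : Idx) (s : Bool), J (bas p s) = (Complex.I ^ p.1.2) • bas (pFlip p) (!s))
    :
    ∀ x ∈ StarAlgebra.adjoin ℂ ({πa, πb} : Set (HH →L[ℂ] HH)),
      ∀ y ∈ StarAlgebra.adjoin ℂ ({πa, πb} : Set (HH →L[ℂ] HH)),
        IsCompactOperator (fun v : HH => x (J (y (-(J v)))) - J (y (-(J (x v))))) := by
  intro x hx y hy
  set S : Set (HH →L[ℂ] HH) := {πa, πb} with hSdef
  have hS : ∀ z ∈ S ∪ star S, ShiftOp q z := by
    have h1 : ∀ z ∈ S, ShiftOp q z := by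
      rintro z (rfl | rfl)
      · exact shiftOp_of_aVal2 hq0 hq1 hπa
      · exact shiftOp_of_bVal2 hq0 hq1 hπb
    rintro z (hz | hz)
    · exact h1 z hz
    · simpa using (h1 _ (Set.mem_star.1 hz)).star hq0
  have hx' : x ∈ Algebra.adjoin ℂ (S ∪ star S) := hx
  have hy' : y ∈ Algebra.adjoin ℂ (S ∪ star S) := hy
  have step : ∀ z ∈ S ∪ star S, IsCompactOperator (x * conjOp J z - conjOp J z * x) :=
    fun z hz => isCompactOperator_commutator_of_mem_adjoin id
      (fun r => ⟨r, Algebra.algebraMap_eq_smul_one r⟩) (fun _ _ => rfl) (fun _ _ => rfl) _ _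
      (fun w hw => (hS w hw).isCompactOperator_commutator hq0 hq1 hJ (hS z hz)) hx'
  have main := isCompactOperator_commutator_of_mem_adjoin (conjOp J)
    (fun r => ⟨starRingEnd ℂ r, ?_⟩) (fun w z => ?_) (conjOp_mul hJ) _ x
    (fun z hz => ?_) hy'
  · have h := main.neg
    rw [← FunLike.coe_neg, neg_sub] at h
    exact h
  · rw [← conjOp_one hJ, Algebra.algebraMap_eq_smul_one]
    ext1 v
    simp [conjOp_apply]
  · ext1 v
    simp [conjOp_apply]
  · have h := (step z hz).neg
    rwa [← FunLike.coe_neg, neg_sub] at h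
end
end
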